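/- arXiv:2003.05152 — 3 statements merged into one kernel-verified Lean document; each statement's English description precedes it below -/
import Mathlib

section
/- Let 𝒬̃ = 𝒬₁ ∪ ℒ ⊆ ℂ[x₁,…,xₙ] be a (Q_o,m₁,0)-set with rank_s(Q_o) ≥ 100, where Q_j = Q_o + a_j·b_j for j ∈ {1,…,m₁} and ℒ = {ℓ₁²,…,ℓ_r²}. Then dim span_ℂ{a₁,…,a_{m₁}, b₁,…,b_{m₁}, ℓ₁,…,ℓ_r} ≤ 7. In particular, since every element of 𝒬̃ lies in span_ℂ({Q_o} ∪ {products of two linear forms from this 7-dimensional space}), dim span_ℂ 𝒬̃ ≤ 29. (The paper assumes rank_s(Q_o) ≥ rkq for an arbitrary sufficiently large absolute constant rkq; rkq = 100 suffices.) -/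
open MvPolynomial

/-- `rankS Q` is the minimal `r` such that `Q = ∑_{i=1}^r a_i · b_i` for linear forms
`a_i, b_i`. -/
noncomputable def rankS {σ : Type*} (Q : MvPolynomial σ ℂ) : ℕ :=
  sInf {r : ℕ | ∃ a b : Fin r → MvPolynomial σ ℂ,
    (∀ i, (a i).IsHomogeneous 1) ∧ (∀ i, (b i).IsHomogeneous 1) ∧ Q = ∑ i, a i * b i}

/-- The family of all polynomials of a `(Q_o,m₁,m₂)`-set: `Q_o`, the `Q_j`'s, the `P_i`'s
and the squares `ℓ_t²`. -/
noncomputable def QoFam {n m₁ m₂ r : ℕ} (Qo : MvPolynomial (Fin n) ℂ)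
    (Qs : Fin m₁ → MvPolynomial (Fin n) ℂ) (Ps : Fin m₂ → MvPolynomial (Fin n) ℂ)
    (ls : Fin r → MvPolynomial (Fin n) ℂ) :
    Unit ⊕ Fin m₁ ⊕ Fin m₂ ⊕ Fin r → MvPolynomial (Fin n) ℂ :=
  Sum.elim (fun _ => Qo) (Sum.elim Qs (Sum.elim Ps fun t => ls t ^ 2))

/-- `𝒬̃ = {Q_o} ∪ {Q_j} ∪ {P_i} ∪ {ℓ_t²}` is a `(Q_o,m₁,m₂)`-set (Definition 4.4 of the
paper). -/
def IsQoSet {n : ℕ} (m₁ m₂ r : ℕ) (Qo : MvPolynomial (Fin n) ℂ)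
    (Qs : Fin m₁ → MvPolynomial (Fin n) ℂ) (Ps : Fin m₂ → MvPolynomial (Fin n) ℂ)
    (ls : Fin r → MvPolynomial (Fin n) ℂ) : Prop :=
  -- the members of 𝒬₁ and 𝒬₂ are irreducible homogeneous quadratics, the ℓ_t are linear
  (Qo.IsHomogeneous 2 ∧ Irreducible Qo) ∧
  (∀ j, (Qs j).IsHomogeneous 2 ∧ Irreducible (Qs j)) ∧
  (∀ i, (Ps i).IsHomogeneous 2 ∧ Irreducible (Ps i)) ∧
  (∀ t, (ls t).IsHomogeneous 1) ∧
  -- (1) pairwise linear independence and the vanishing (radical-membership) condition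
  (∀ i j, i ≠ j →
    LinearIndependent ℂ ![QoFam Qo Qs Ps ls i, QoFam Qo Qs Ps ls j]) ∧
  (∀ i j, i ≠ j →
    (∏ k ∈ (Finset.univ.erase i).erase j, QoFam Qo Qs Ps ls k) ∈
      (Ideal.span {QoFam Qo Qs Ps ls i, QoFam Qo Qs Ps ls j}).radical) ∧
  -- (2)
  (5 * m₂ + 2 < m₁) ∧
  -- (3)
  (∀ j, ∃ a b : MvPolynomial (Fin n) ℂ,
    a.IsHomogeneous 1 ∧ b.IsHomogeneous 1 ∧ Qs j = Qo + a * b) ∧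
  -- (4)
  (∀ i, ∀ α β : ℂ, ¬(α = 0 ∧ β = 0) → 2 ≤ rankS (α • Ps i + β • Qo)) ∧
  -- (5)
  Set.ncard {i : Unit ⊕ Fin m₁ ⊕ Fin m₂ |
    ∃ c d : MvPolynomial (Fin n) ℂ, c.IsHomogeneous 1 ∧ d.IsHomogeneous 1 ∧
      Sum.elim (fun _ => Qo) (Sum.elim Qs Ps) i ∈ Ideal.span {c, d} ∧
      Qo ∈ Ideal.span {c, d}} ≤ m₂

theorem sq_trace_le_rank_mul_sum_sq {ι : Type*} [Fintype ι] [DecidableEq ι]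
    {M : Matrix ι ι ℂ} (hM : M.IsHermitian) :
    M.trace.re ^ 2 ≤ M.rank * ∑ i, ∑ j, ‖M i j‖ ^ 2 := by
  have htr : M.trace.re = ∑ i, hM.eigenvalues i := by
    rw [hM.trace_eq_sum_eigenvalues]; simp
  have hsq : ∑ i, ∑ j, ‖M i j‖ ^ 2 = ∑ i, hM.eigenvalues i ^ 2 := by
    have h1 : (M * M).trace = ((∑ i, ∑ j, ‖M i j‖ ^ 2 : ℝ) : ℂ) := by
      simp only [Matrix.trace, Matrix.diag_apply, Matrix.mul_apply]
      push_cast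
      refine Finset.sum_congr rfl fun i _ => Finset.sum_congr rfl fun j _ => ?_
      rw [← hM.apply j i, ← Complex.mul_conj']
      rfl
    have h2 : (M * M).trace = ((∑ i, hM.eigenvalues i ^ 2 : ℝ) : ℂ) := by
      conv_lhs => rw [hM.spectral_theorem, ← map_mul, Unitary.conjStarAlgAut_apply,
        Matrix.trace_mul_cycle, Unitary.coe_star_mul_self, one_mul,
        Matrix.diagonal_mul_diagonal, Matrix.trace_diagonal]
      push_cast
      exact Finset.sum_congr rfl fun i _ => by simp [sq]
    exact_mod_cast h1.symm.trans h2
  have hrk : (M.rank : ℝ) = ∑ i, (if hM.eigenvalues i ≠ 0 then (1 : ℝ) else 0) ^ 2 := by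
    rw [hM.rank_eq_card_non_zero_eigs, Fintype.card_subtype]
    simp [Finset.sum_ite]
  rw [htr, hsq, hrk]
  refine le_trans (le_of_eq ?_) (Finset.sum_mul_sq_le_sq_mul_sq Finset.univ _ _)
  congr 1
  refine Finset.sum_congr rfl fun i _ => ?_
  by_cases h : hM.eigenvalues i = 0 <;> simp [h]

open Finset in
theorem exists_scaling {ι : Type*} [Fintype ι] [DecidableEq ι] (T : Finset (Finset ι))
    (w : Finset ι → ℝ) (hw : ∀ τ ∈ T, 0 ≤ w τ) (hcard : ∀ τ ∈ T, #τ = 3)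
    (r : Finset ι → ι → ℝ) (hr : ∀ τ ∈ T, ∀ l ∈ τ, 0 < r τ l) (c : ℝ) (hc : 0 ≤ c)
    (hdeg : ∀ l, ∑ τ ∈ T, (if l ∈ τ then w τ else 0) = 3 * c) {δ : ℝ} (hδ : 0 < δ) :
    ∃ x : ι → ℝ, ∀ i, ∑ τ ∈ T, w τ *
      (if i ∈ τ then r τ i * Real.exp (x i) / ∑ l ∈ τ, r τ l * Real.exp (x l) else 0)
        ≤ c + δ := by
  set s : Finset ι → (ι → ℝ) → ℝ := fun τ x => ∑ l ∈ τ, r τ l * Real.exp (x l) with hs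
  have hspos : ∀ τ ∈ T, ∀ x, 0 < s τ x := fun τ hτ x =>
    Finset.sum_pos (fun l hl => mul_pos (hr τ hτ l hl) (Real.exp_pos _))
      (Finset.card_pos.mp (by rw [hcard τ hτ]; norm_num))
  set f : (ι → ℝ) → ℝ := fun x => ∑ τ ∈ T, w τ * Real.log (s τ x) - c * ∑ l, x l with hf
  have hdouble : ∀ x : ι → ℝ, ∑ τ ∈ T, w τ * ((∑ l ∈ τ, x l) / 3) = c * ∑ l, x l := by
    intro x
    have : ∀ τ ∈ T, w τ * ((∑ l ∈ τ, x l) / 3)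
        = ∑ l, (if l ∈ τ then w τ else 0) * (x l / 3) := by
      intro τ _
      simp [ite_mul, Finset.sum_ite_mem, Finset.mul_sum, Finset.sum_div]
    rw [Finset.sum_congr rfl this, Finset.sum_comm, Finset.mul_sum]
    refine Finset.sum_congr rfl fun l _ => ?_
    rw [← Finset.sum_mul, hdeg]; ring
  have hbdd : BddBelow (Set.range f) := by
    refine ⟨∑ τ ∈ T, w τ * ((∑ l ∈ τ, Real.log (r τ l)) / 3), ?_⟩
    rintro _ ⟨x, rfl⟩
    rw [hf]
    simp only
    rw [← hdouble x, ← Finset.sum_sub_distrib]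
    refine Finset.sum_le_sum fun τ hτ => ?_
    rw [← mul_sub]
    refine mul_le_mul_of_nonneg_left ?_ (hw τ hτ)
    have hle : ∀ l ∈ τ, Real.log (r τ l) + x l ≤ Real.log (s τ x) := by
      intro l hl
      rw [← Real.log_exp (x l), ← Real.log_mul (hr τ hτ l hl).ne' (Real.exp_pos _).ne']
      refine Real.log_le_log (mul_pos (hr τ hτ l hl) (Real.exp_pos _)) ?_
      exact Finset.single_le_sum (f := fun l => r τ l * Real.exp (x l))
        (fun k hk => (mul_pos (hr τ hτ k hk) (Real.exp_pos _)).le) hl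
    have := Finset.sum_le_sum hle
    rw [Finset.sum_add_distrib, Finset.sum_const, hcard τ hτ] at this
    simp only [nsmul_eq_mul] at this
    push_cast at this
    linarith
  obtain ⟨t, ht0, ht⟩ : ∃ t : ℝ, 0 < t ∧ (c + t) * (1 + t) ≤ c + δ := by
    refine ⟨min 1 (δ / (c + 2)), lt_min one_pos (by positivity), ?_⟩
    have h1 : min 1 (δ / (c + 2)) ≤ 1 := min_le_left _ _
    have h2 : min 1 (δ / (c + 2)) ≤ δ / (c + 2) := min_le_right _ _
    have h3 : 0 < min 1 (δ / (c + 2)) := lt_min one_pos (by positivity)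
    rw [le_div_iff₀ (by positivity)] at h2
    nlinarith
  obtain ⟨_, ⟨x, rfl⟩, hx⟩ := Real.lt_sInf_add_pos (Set.range_nonempty f) (pow_pos ht0 2)
  refine ⟨x, fun i => ?_⟩
  set D := ∑ τ ∈ T, w τ *
      (if i ∈ τ then r τ i * Real.exp (x i) / ∑ l ∈ τ, r τ l * Real.exp (x l) else 0) with hD
  have hD0 : 0 ≤ D := Finset.sum_nonneg fun τ hτ => mul_nonneg (hw τ hτ) (by
    split_ifs with h
    · exact div_nonneg (mul_pos (hr τ hτ i h) (Real.exp_pos _)).le (hspos τ hτ x).le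
    · exact le_rfl)
  set y := Function.update x i (x i - t) with hy
  have hfy : sInf (Set.range f) ≤ f y := csInf_le hbdd ⟨y, rfl⟩
  have hsum : ∑ l, y l = ∑ l, x l - t := by
    rw [hy, Finset.sum_update_of_mem (Finset.mem_univ i), ← Finset.add_sum_erase _ x
      (Finset.mem_univ i), Finset.sdiff_singleton_eq_erase]
    ring
  have hstep : ∀ τ ∈ T, w τ * Real.log (s τ y) - w τ * Real.log (s τ x) ≤
      - (1 - Real.exp (-t)) * (w τ *
      (if i ∈ τ then r τ i * Real.exp (x i) / ∑ l ∈ τ, r τ l * Real.exp (x l) else 0)) := by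
    intro τ hτ
    have hlog : Real.log (s τ y) - Real.log (s τ x) ≤ s τ y / s τ x - 1 := by
      rw [← Real.log_div (hspos τ hτ y).ne' (hspos τ hτ x).ne']
      exact Real.log_le_sub_one_of_pos (div_pos (hspos τ hτ y) (hspos τ hτ x))
    have hval : s τ y / s τ x - 1 = - (1 - Real.exp (-t)) *
      (if i ∈ τ then r τ i * Real.exp (x i) / ∑ l ∈ τ, r τ l * Real.exp (x l) else 0) := by
      have hsy : s τ y = s τ x -
          (1 - Real.exp (-t)) * (if i ∈ τ then r τ i * Real.exp (x i) else 0) := by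
        simp only [hs]
        rw [eq_sub_iff_add_eq]
        by_cases hi : i ∈ τ
        · rw [if_pos hi, ← Finset.add_sum_erase _ _ hi, ← Finset.add_sum_erase τ
            (fun l => r τ l * Real.exp (x l)) hi]
          have : ∑ l ∈ τ.erase i, r τ l * Real.exp (y l)
              = ∑ l ∈ τ.erase i, r τ l * Real.exp (x l) :=
            Finset.sum_congr rfl fun l hl => by
              rw [hy, Function.update_of_ne (Finset.ne_of_mem_erase hl)]
          rw [this, hy, Function.update_self, sub_eq_add_neg (x i), Real.exp_add]
          ring
        · rw [if_neg hi, mul_zero, add_zero]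
          refine Finset.sum_congr rfl fun l hl => ?_
          rw [hy, Function.update_of_ne]
          rintro rfl; exact hi hl
      have hne := (hspos τ hτ x).ne'
      rw [hsy, sub_div, div_self hne]
      split_ifs with hi
      · simp only [hs]; ring
      · ring
    rw [hval] at hlog
    rw [← mul_sub]
    calc _ ≤ _ := mul_le_mul_of_nonneg_left hlog (hw τ hτ)
      _ = _ := by ring
  have hdiff : f y - f x ≤ - (1 - Real.exp (-t)) * D + c * t := by
    have := Finset.sum_le_sum hstep
    rw [Finset.sum_sub_distrib, ← Finset.mul_sum] at this
    simp only [hf]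
    rw [hsum]
    linarith
  have hkey : (1 - Real.exp (-t)) * D ≤ t * (c + t) := by nlinarith
  have hexp : t / (1 + t) ≤ 1 - Real.exp (-t) := by
    rw [Real.exp_neg]
    have h1 : 1 + t ≤ Real.exp t := by linarith [Real.add_one_le_exp t]
    have h2 : (Real.exp t)⁻¹ ≤ (1 + t)⁻¹ := inv_anti₀ (by positivity) h1
    have h3 : t / (1 + t) = 1 - (1 + t)⁻¹ := by field_simp; ring
    linarith
  have h4 : t / (1 + t) * D ≤ t * (c + t) :=
    (mul_le_mul_of_nonneg_right hexp hD0).trans hkey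
  rw [div_mul_eq_mul_div, div_le_iff₀ (by positivity)] at h4
  have h5 : D ≤ (c + t) * (1 + t) := by nlinarith
  linarith

open Finset ComplexConjugate in
theorem finrank_span_le_three_of_design {ι E : Type*} [Fintype ι] [DecidableEq ι]
    [AddCommGroup E] [Module ℂ E] (v : ι → E) (T : Finset (Finset ι))
    (w : Finset ι → ℝ) (hw : ∀ τ ∈ T, 0 ≤ w τ) (hcard : ∀ τ ∈ T, #τ = 3)
    (hpair : ∀ i j, i ≠ j → ∑ τ ∈ T, (if i ∈ τ ∧ j ∈ τ then w τ else 0) = 1)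
    (R : Finset ι → ι → ℂ) (hR : ∀ τ ∈ T, ∀ l ∈ τ, R τ l ≠ 0)
    (hrel : ∀ τ ∈ T, ∑ l ∈ τ, R τ l • v l = 0) :
    Module.finrank ℂ (Submodule.span ℂ (Set.range v)) ≤ 3 := by
  by_contra! hd
  set S := Submodule.span ℂ (Set.range v) with hS
  set n := Fintype.card ι with hn
  have hdn : Module.finrank ℂ S ≤ n := finrank_range_le_card v
  have hn4 : (4 : ℝ) ≤ n := by exact_mod_cast (Nat.succ_le_of_lt hd).trans hdn
  set c : ℝ := (n - 1) / 6 with hc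
  have hc0 : 0 < c := by rw [hc]; linarith
  have hdeg : ∀ i, ∑ τ ∈ T, (if i ∈ τ then w τ else 0) = 3 * c := by
    intro i
    have h1 : ∑ j ∈ univ.erase i, ∑ τ ∈ T, (if i ∈ τ ∧ j ∈ τ then w τ else 0) = n - 1 := by
      rw [Finset.sum_congr rfl fun j hj => hpair i j (ne_of_mem_erase hj).symm]
      rw [Finset.sum_const, card_erase_of_mem (mem_univ i), nsmul_eq_mul, mul_one, card_univ,
        Nat.cast_sub (by have : (1 : ℝ) ≤ n := by linarith
                         exact_mod_cast this)]
      simp [hn]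
    rw [Finset.sum_comm] at h1
    have h2 : ∀ τ ∈ T, ∑ j ∈ univ.erase i, (if i ∈ τ ∧ j ∈ τ then w τ else 0)
        = 2 * (if i ∈ τ then w τ else 0) := by
      intro τ hτ
      by_cases hi : i ∈ τ
      · simp only [hi, true_and, if_true]
        rw [← Finset.sum_filter, Finset.sum_const]
        have : (univ.erase i).filter (· ∈ τ) = τ.erase i := by
          ext j; simp
        rw [this, card_erase_of_mem hi, hcard τ hτ]
        simp
      · simp [hi]
    rw [Finset.sum_congr rfl h2, ← Finset.mul_sum] at h1
    rw [hc]; linarith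
  have hm : ∑ τ ∈ T, w τ = c * n := by
    have h1 : ∑ i, ∑ τ ∈ T, (if i ∈ τ then w τ else 0) = n * (3 * c) := by
      rw [Finset.sum_congr rfl fun i _ => hdeg i, Finset.sum_const, card_univ, nsmul_eq_mul]
    rw [Finset.sum_comm] at h1
    have h2 : ∀ τ ∈ T, ∑ i, (if i ∈ τ then w τ else 0) = 3 * w τ := by
      intro τ hτ
      rw [← Finset.sum_filter, Finset.sum_const]
      simp [hcard τ hτ]
    rw [Finset.sum_congr rfl h2, ← Finset.mul_sum] at h1
    linarith
  have hn0 : (0 : ℝ) < n := by linarith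
  obtain ⟨x, hx⟩ := exists_scaling T w hw hcard (fun τ l => ‖R τ l‖ ^ 2)
    (fun τ hτ l hl => pow_pos (norm_pos_iff.mpr (hR τ hτ l hl)) 2) c hc0.le hdeg
    (δ := 1 / n) (by positivity)
  set s : Finset ι → ℝ := fun τ => ∑ l ∈ τ, ‖R τ l‖ ^ 2 * Real.exp (x l) with hs
  have hspos : ∀ τ ∈ T, 0 < s τ := fun τ hτ =>
    Finset.sum_pos (fun l hl => mul_pos (pow_pos (norm_pos_iff.mpr (hR τ hτ l hl)) 2)
      (Real.exp_pos _)) (Finset.card_pos.mp (by rw [hcard τ hτ]; norm_num))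
  set q : Finset ι → ι → ℝ := fun τ i =>
    if i ∈ τ then ‖R τ i‖ ^ 2 * Real.exp (x i) / s τ else 0 with hq
  have hq0 : ∀ τ ∈ T, ∀ i, 0 ≤ q τ i := by
    intro τ hτ i
    simp only [hq]
    split_ifs
    · exact div_nonneg (by positivity) (hspos τ hτ).le
    · exact le_rfl
  have hqsum : ∀ τ ∈ T, ∑ i, q τ i = 1 := by
    intro τ hτ
    simp only [hq]
    rw [Finset.sum_ite_mem, univ_inter, ← Finset.sum_div]
    exact div_self (hspos τ hτ).ne'
  have hqsq : ∀ τ ∈ T, 1 / 3 ≤ ∑ i, q τ i ^ 2 := by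
    intro τ hτ
    have h1 : ∑ i ∈ τ, q τ i = 1 := by
      rw [← hqsum τ hτ]
      exact Finset.sum_subset (subset_univ τ) fun i _ hi => by simp [hq, hi]
    have h2 := sq_sum_le_card_mul_sum_sq (s := τ) (f := q τ)
    rw [h1, hcard τ hτ] at h2
    have h3 : ∑ i ∈ τ, q τ i ^ 2 ≤ ∑ i, q τ i ^ 2 :=
      Finset.sum_le_sum_of_subset_of_nonneg (subset_univ τ) fun i _ _ => sq_nonneg _
    push_cast at h2
    linarith
  set N : Finset ι → ι → ℂ := fun τ i =>
    if i ∈ τ then R τ i * Real.exp (x i / 2) / Real.sqrt (s τ) else 0 with hN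
  have hNq : ∀ τ ∈ T, ∀ i, ‖N τ i‖ ^ 2 = q τ i := by
    intro τ hτ i
    simp only [hN, hq]
    split_ifs
    · rw [norm_div, norm_mul, Complex.norm_real, Complex.norm_real, Real.norm_eq_abs,
        Real.norm_eq_abs, abs_of_pos (Real.exp_pos _), abs_of_nonneg (Real.sqrt_nonneg _),
        div_pow, mul_pow, Real.sq_sqrt (hspos τ hτ).le, ← Real.exp_nat_mul]
      congr 3
      push_cast; ring
    · simp
  set M : Matrix ι ι ℂ := Matrix.of fun i j => ∑ τ ∈ T, (w τ : ℂ) * (conj (N τ i) * N τ j)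
    with hMdef
  have hM : M.IsHermitian := by
    ext i j
    simp only [hMdef, Matrix.conjTranspose_apply, Matrix.of_apply, star_sum, star_mul']
    refine Finset.sum_congr rfl fun τ _ => ?_
    simp [mul_comm]
  set D : ι → ℝ := fun i => ∑ τ ∈ T, w τ * q τ i with hD
  have hD0 : ∀ i, 0 ≤ D i := fun i =>
    Finset.sum_nonneg fun τ hτ => mul_nonneg (hw τ hτ) (hq0 τ hτ i)
  have hDle : ∀ i, D i ≤ c + 1 / n := hx
  have hDsum : ∑ i, D i = c * n := by
    simp only [hD]
    rw [Finset.sum_comm, ← hm]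
    refine Finset.sum_congr rfl fun τ hτ => ?_
    rw [← Finset.mul_sum, hqsum τ hτ, mul_one]
  have hdiag : ∀ i, M i i = (D i : ℂ) := by
    intro i
    simp only [hMdef, Matrix.of_apply, hD]
    push_cast
    refine Finset.sum_congr rfl fun τ hτ => ?_
    rw [← hNq τ hτ, Complex.conj_mul']
    push_cast; rfl
  have htrace : M.trace.re = c * n := by
    rw [Matrix.trace, Finset.sum_congr rfl fun i _ => by rw [Matrix.diag_apply, hdiag i],
      ← Complex.ofReal_sum, Complex.ofReal_re, hDsum]
  have hoff : ∀ i j, i ≠ j → ‖M i j‖ ^ 2 ≤ ∑ τ ∈ T, w τ * (q τ i * q τ j) := by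
    intro i j hij
    have h1 : ‖M i j‖ ≤ ∑ τ ∈ T, Real.sqrt (if i ∈ τ ∧ j ∈ τ then w τ else 0) *
        (Real.sqrt (w τ) * (‖N τ i‖ * ‖N τ j‖)) := by
      simp only [hMdef, Matrix.of_apply]
      refine (norm_sum_le _ _).trans (le_of_eq (Finset.sum_congr rfl fun τ hτ => ?_))
      rw [norm_mul, norm_mul, Complex.norm_real, Complex.norm_conj, Real.norm_eq_abs,
        abs_of_nonneg (hw τ hτ)]
      split_ifs with h
      · rw [← mul_assoc (Real.sqrt _), Real.mul_self_sqrt (hw τ hτ)]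
      · have : ‖N τ i‖ * ‖N τ j‖ = 0 := by
          rw [not_and_or] at h
          rcases h with h | h <;> simp [hN, h]
        rw [this]; simp
    have h2 := Finset.sum_mul_sq_le_sq_mul_sq T
      (fun τ => Real.sqrt (if i ∈ τ ∧ j ∈ τ then w τ else 0))
      (fun τ => Real.sqrt (w τ) * (‖N τ i‖ * ‖N τ j‖))
    have h3 : ∑ τ ∈ T, Real.sqrt (if i ∈ τ ∧ j ∈ τ then w τ else 0) ^ 2 = 1 := by
      rw [← hpair i j hij]
      refine Finset.sum_congr rfl fun τ hτ => Real.sq_sqrt ?_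
      split_ifs
      · exact hw τ hτ
      · exact le_rfl
    have h4 : ∑ τ ∈ T, (Real.sqrt (w τ) * (‖N τ i‖ * ‖N τ j‖)) ^ 2
        = ∑ τ ∈ T, w τ * (q τ i * q τ j) := by
      refine Finset.sum_congr rfl fun τ hτ => ?_
      rw [mul_pow, mul_pow, Real.sq_sqrt (hw τ hτ), hNq τ hτ, hNq τ hτ]
    rw [h3, h4, one_mul] at h2
    exact (pow_le_pow_left₀ (norm_nonneg _) h1 2).trans h2
  have hfrob : ∑ i, ∑ j, ‖M i j‖ ^ 2 ≤ (c + 1 / n) * (c * n) + 2 / 3 * (c * n) := by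
    have h1 : ∀ i j, ‖M i j‖ ^ 2 ≤ (if i = j then D i ^ 2 else 0) +
        ∑ τ ∈ T, w τ * (q τ i * q τ j - if i = j then q τ i ^ 2 else 0) := by
      intro i j
      by_cases h : i = j
      · subst h
        rw [hdiag, Complex.norm_real, Real.norm_eq_abs, sq_abs]
        simp [sq]
      · simpa [h] using hoff i j h
    refine (Finset.sum_le_sum fun i _ => Finset.sum_le_sum fun j _ => h1 i j).trans ?_
    simp only [Finset.sum_add_distrib]
    have h2 : ∑ i, ∑ j, (if i = j then D i ^ 2 else 0) ≤ (c + 1 / n) * (c * n) := by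
      simp only [Finset.sum_ite_eq, mem_univ, if_true]
      rw [← hDsum, Finset.mul_sum]
      refine Finset.sum_le_sum fun i _ => ?_
      rw [sq]
      exact mul_le_mul_of_nonneg_right (hDle i) (hD0 i)
    have h3 : ∑ i, ∑ j, ∑ τ ∈ T, w τ * (q τ i * q τ j - if i = j then q τ i ^ 2 else 0)
        ≤ 2 / 3 * (c * n) := by
      have : ∀ i, ∑ j, ∑ τ ∈ T, w τ * (q τ i * q τ j - if i = j then q τ i ^ 2 else 0)
          = ∑ τ ∈ T, w τ * (q τ i - q τ i ^ 2) := by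
        intro i
        rw [Finset.sum_comm]
        refine Finset.sum_congr rfl fun τ hτ => ?_
        rw [← Finset.mul_sum, Finset.sum_sub_distrib, ← Finset.mul_sum, hqsum τ hτ]
        simp
      rw [Finset.sum_congr rfl fun i _ => this i, Finset.sum_comm, ← hm, Finset.mul_sum]
      refine Finset.sum_le_sum fun τ hτ => ?_
      rw [← Finset.mul_sum, Finset.sum_sub_distrib, hqsum τ hτ, mul_comm (2 / 3 : ℝ)]
      exact mul_le_mul_of_nonneg_left (by linarith [hqsq τ hτ]) (hw τ hτ)
    linarith
  have hrank : M.rank + Module.finrank ℂ S ≤ n := by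
    have hker : Module.finrank ℂ S ≤ Module.finrank ℂ (LinearMap.ker M.mulVecLin) := by
      let Φ : Module.Dual ℂ S →ₗ[ℂ] (ι → ℂ) := LinearMap.pi fun l =>
        (Real.exp (-(x l / 2)) : ℂ) • Module.Dual.eval ℂ S
          ⟨v l, Submodule.subset_span ⟨l, rfl⟩⟩
      have hΦ : ∀ f l, Φ f l = (Real.exp (-(x l / 2)) : ℂ) *
          f ⟨v l, Submodule.subset_span ⟨l, rfl⟩⟩ := fun f l => rfl
      have hinj : Function.Injective Φ := by
        rw [injective_iff_map_eq_zero]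
        intro f hf
        have h1 : ∀ l, f ⟨v l, Submodule.subset_span ⟨l, rfl⟩⟩ = 0 := by
          intro l
          have := congrFun hf l
          rw [hΦ] at this
          simpa using this
        ext ⟨y, hy⟩
        induction hy using Submodule.span_induction with
        | mem y hy => obtain ⟨l, rfl⟩ := hy; exact h1 l
        | zero => exact map_zero f
        | add y z hy hz h h' =>
          have := map_add f ⟨y, hy⟩ ⟨z, hz⟩
          rw [h, h'] at this
          simpa using this
        | smul a y hy h =>
          have := map_smul f a ⟨y, hy⟩
          rw [h] at this
          simpa using this
      have hmem : ∀ f, Φ f ∈ LinearMap.ker M.mulVecLin := by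
        intro f
        rw [LinearMap.mem_ker]
        ext i
        simp only [Matrix.mulVecLin_apply, Matrix.mulVec, dotProduct, hMdef, Matrix.of_apply,
          Pi.zero_apply, Finset.sum_mul]
        rw [Finset.sum_comm]
        refine Finset.sum_eq_zero fun τ hτ => ?_
        have h0 : ∑ j, N τ j * Φ f j = 0 := by
          have h1 : ∀ j, N τ j * Φ f j = if j ∈ τ then
              (Real.sqrt (s τ) : ℂ)⁻¹ *
                f (R τ j • ⟨v j, Submodule.subset_span ⟨j, rfl⟩⟩) else 0 := by
            intro j
            simp only [hN, hΦ, map_smul, smul_eq_mul]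
            split_ifs
            · have : (Real.exp (x j / 2) : ℂ) * Real.exp (-(x j / 2)) = 1 := by
                rw [← Complex.ofReal_mul, ← Real.exp_add]; simp
              linear_combination ((R τ j) * (Real.sqrt (s τ) : ℂ)⁻¹ *
                f ⟨v j, Submodule.subset_span ⟨j, rfl⟩⟩) * this
            · simp
          rw [Finset.sum_congr rfl fun j _ => h1 j, Finset.sum_ite_mem, univ_inter,
            ← Finset.mul_sum, ← map_sum]
          have h2 : ∑ j ∈ τ, R τ j • (⟨v j, Submodule.subset_span ⟨j, rfl⟩⟩ : S) = 0 := by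
            apply Subtype.ext
            simpa using hrel τ hτ
          rw [h2, map_zero, mul_zero]
        calc _ = (w τ : ℂ) * conj (N τ i) * ∑ j, N τ j * Φ f j := by
              rw [Finset.mul_sum]
              exact Finset.sum_congr rfl fun j _ => by ring
          _ = 0 := by rw [h0, mul_zero]
      have h1 := LinearMap.finrank_le_finrank_of_injective
        (f := Φ.codRestrict (LinearMap.ker M.mulVecLin) hmem)
        (fun a b hab => hinj (congrArg Subtype.val hab))
      have : FiniteDimensional ℂ S := FiniteDimensional.span_of_finite ℂ (Set.finite_range v)
      rwa [Subspace.dual_finrank_eq] at h1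
    have h2 := LinearMap.finrank_range_add_finrank_ker M.mulVecLin
    rw [Module.finrank_pi] at h2
    have : M.rank = Module.finrank ℂ (LinearMap.range M.mulVecLin) := rfl
    omega
  have hmain := sq_trace_le_rank_mul_sum_sq hM
  rw [htrace] at hmain
  have hrank' : (M.rank : ℝ) ≤ n - 4 := by
    have : M.rank + 4 ≤ n := by omega
    have : (M.rank : ℝ) + 4 ≤ n := by exact_mod_cast this
    linarith
  have h1 : (c * n) ^ 2 ≤ (n - 4) * ((c + 1 / n) * (c * n) + 2 / 3 * (c * n)) :=
    hmain.trans (mul_le_mul hrank' hfrob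
      (Finset.sum_nonneg fun i _ => Finset.sum_nonneg fun j _ => sq_nonneg _) (by linarith))
  have h2 : c * n ≤ (n - 4) * (c + 1 / n + 2 / 3) := by
    refine le_of_mul_le_mul_right ?_ (mul_pos hc0 hn0)
    linarith
  have h3 : (n - 4) * (1 / n : ℝ) < 1 := by
    rw [mul_one_div, div_lt_one hn0]; linarith
  rw [hc] at h2
  nlinarith

open Finset in
theorem finrank_span_le_three_of_pairwise {ι E : Type*} [Fintype ι] [DecidableEq ι]
    [AddCommGroup E] [Module ℂ E] (v : ι → E)
    (hli : ∀ i j, i ≠ j → LinearIndependent ℂ ![v i, v j])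
    (hSG : ∀ i j, i ≠ j → ∃ k, k ≠ i ∧ k ≠ j ∧ v k ∈ Submodule.span ℂ {v i, v j}) :
    Module.finrank ℂ (Submodule.span ℂ (Set.range v)) ≤ 3 := by
  classical
  let L : Finset ι → Submodule ℂ E := fun τ => Submodule.span ℂ (v '' τ)
  have hLfd : ∀ τ, FiniteDimensional ℂ (L τ) := fun τ =>
    FiniteDimensional.span_of_finite ℂ (τ.finite_toSet.image v)
  have hpairrank : ∀ i j, i ≠ j → Module.finrank ℂ (Submodule.span ℂ {v i, v j}) = 2 := by
    intro i j hij
    have hset : ({v i, v j} : Set E) = Set.range ![v i, v j] := by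
      rw [Matrix.range_cons, Matrix.range_cons, Matrix.range_empty, Set.union_empty]
      rfl
    rw [hset, finrank_span_eq_card (hli i j hij), Fintype.card_fin]
  let T : Finset (Finset ι) := univ.filter fun τ => #τ = 3 ∧ Module.finrank ℂ (L τ) = 2
  have hT : ∀ τ, τ ∈ T ↔ #τ = 3 ∧ Module.finrank ℂ (L τ) = 2 := fun τ => by simp [T]
  have hline : ∀ τ ∈ T, ∀ i ∈ τ, ∀ j ∈ τ, i ≠ j → Submodule.span ℂ {v i, v j} = L τ := by
    intro τ hτ i hi j hj hij
    have := hLfd τ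
    refine Submodule.eq_of_le_of_finrank_eq (Submodule.span_mono ?_) ?_
    · rintro _ (rfl | rfl)
      · exact ⟨i, hi, rfl⟩
      · exact ⟨j, hj, rfl⟩
    · rw [hpairrank i j hij, ((hT τ).mp hτ).2]
  let N : Submodule ℂ E → ℕ := fun W => #(univ.filter fun l => v l ∈ W)
  let w : Finset ι → ℝ := fun τ => 1 / ((N (L τ) : ℝ) - 2)
  have hN2 : ∀ i j, i ≠ j → N (Submodule.span ℂ {v i, v j}) =
      #(univ.filter fun k => k ≠ i ∧ k ≠ j ∧ v k ∈ Submodule.span ℂ {v i, v j}) + 2 := by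
    intro i j hij
    have : (univ.filter fun l => v l ∈ Submodule.span ℂ {v i, v j}) =
      insert i (insert j (univ.filter fun k => k ≠ i ∧ k ≠ j ∧
        v k ∈ Submodule.span ℂ {v i, v j})) := by
      ext l
      simp only [mem_filter, mem_univ, true_and, mem_insert]
      constructor
      · intro h; by_cases h1 : l = i <;> by_cases h2 : l = j <;> simp [*]
      · rintro (rfl | rfl | h)
        · exact Submodule.subset_span (by simp)
        · exact Submodule.subset_span (by simp)
        · exact h.2.2
    simp only [N]
    rw [this, card_insert_of_notMem (by simp [hij]), card_insert_of_notMem (by simp)]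
  have hrelex : ∀ τ, ∃ R : ι → ℂ, τ ∈ T →
      (∀ l ∈ τ, R l ≠ 0) ∧ ∑ l ∈ τ, R l • v l = 0 := by
    intro τ
    by_cases hτ : τ ∈ T
    swap
    · exact ⟨0, fun h => absurd h hτ⟩
    obtain ⟨i, j, k, hij, hik, hjk, hτe⟩ := card_eq_three.mp ((hT τ).mp hτ).1
    have hk : v k ∈ Submodule.span ℂ {v i, v j} := by
      rw [hline τ hτ i (by simp [hτe]) j (by simp [hτe]) hij]
      exact Submodule.subset_span ⟨k, by simp [hτe], rfl⟩
    obtain ⟨s, t, hst⟩ := Submodule.mem_span_pair.mp hk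
    have hs : s ≠ 0 := by
      rintro rfl
      have := (LinearIndependent.pair_iff.mp (hli j k hjk)) t (-1) (by rw [← hst]; simp)
      simp at this
    have ht : t ≠ 0 := by
      rintro rfl
      have := (LinearIndependent.pair_iff.mp (hli i k hik)) s (-1) (by rw [← hst]; simp)
      simp at this
    refine ⟨fun l => if l = i then s else if l = j then t else -1, fun _ => ⟨?_, ?_⟩⟩
    · intro l _
      dsimp only
      split_ifs <;> simp [*]
    · rw [hτe, sum_insert (by simp [hij, hik]), sum_insert (by simp [hjk]), sum_singleton]
      simp [hij.symm, hik.symm, hjk.symm, ← hst]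
  choose R hR using hrelex
  refine finrank_span_le_three_of_design v T w ?_ (fun τ hτ => ((hT τ).mp hτ).1) ?_ R
    (fun τ hτ => (hR τ hτ).1) (fun τ hτ => (hR τ hτ).2)
  · intro τ hτ
    obtain ⟨i, j, k, hij, hik, hjk, hτe⟩ := card_eq_three.mp ((hT τ).mp hτ).1
    have h1 := hline τ hτ i (by simp [hτe]) j (by simp [hτe]) hij
    simp only [w]
    rw [← h1, hN2 i j hij]
    push_cast
    rw [add_sub_cancel_right]
    positivity
  · intro i j hij
    set K := univ.filter fun k => k ≠ i ∧ k ≠ j ∧ v k ∈ Submodule.span ℂ {v i, v j} with hK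
    have hfilter : (T.filter fun τ => i ∈ τ ∧ j ∈ τ) = K.image fun k => {i, j, k} := by
      ext τ
      simp only [mem_filter, mem_image]
      constructor
      · rintro ⟨hτ, hi, hj⟩
        have h1 : #((τ.erase i).erase j) = 1 := by
          rw [card_erase_of_mem (by simp [hj, hij.symm]), card_erase_of_mem hi,
            ((hT τ).mp hτ).1]
        obtain ⟨k, hk⟩ := card_eq_one.mp h1
        have hkm : k ∈ (τ.erase i).erase j := by simp [hk]
        simp only [mem_erase] at hkm
        refine ⟨k, ?_, ?_⟩
        · simp only [hK, mem_filter, mem_univ, true_and]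
          refine ⟨hkm.2.1, hkm.1, ?_⟩
          rw [hline τ hτ i hi j hj hij]
          exact Submodule.subset_span ⟨k, hkm.2.2, rfl⟩
        · rw [← hk, insert_erase (by simp [hj, hij.symm]), insert_erase hi]
      · rintro ⟨k, hk, rfl⟩
        simp only [hK, mem_filter, mem_univ, true_and] at hk
        refine ⟨(hT _).mpr ⟨card_eq_three.mpr ⟨i, j, k, hij, hk.1.symm, hk.2.1.symm, rfl⟩, ?_⟩,
          by simp, by simp⟩
        have : L {i, j, k} = Submodule.span ℂ {v i, v j} := by
          refine le_antisymm (Submodule.span_le.mpr ?_) (Submodule.span_mono ?_)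
          · rintro _ ⟨l, hl, rfl⟩
            simp only [coe_insert, coe_singleton, Set.mem_insert_iff,
              Set.mem_singleton_iff] at hl
            rcases hl with rfl | rfl | rfl
            · exact Submodule.subset_span (by simp)
            · exact Submodule.subset_span (by simp)
            · exact hk.2.2
          · rintro _ (rfl | rfl)
            · exact ⟨i, by simp, rfl⟩
            · exact ⟨j, by simp, rfl⟩
        rw [this, hpairrank i j hij]
    have hcardK : #(K.image fun k => ({i, j, k} : Finset ι)) = #K := by
      refine card_image_of_injOn ?_
      intro k hk l hl hkl
      simp only [hK, coe_filter, mem_univ, true_and, Set.mem_ofPred_eq] at hk hl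
      have : k ∈ ({i, j, l} : Finset ι) := by
        have hkl' : ({i, j, k} : Finset ι) = {i, j, l} := hkl
        rw [← hkl']; simp
      simpa [hk.1, hk.2.1] using this
    have hKpos : 0 < #K := by
      obtain ⟨k, h1, h2, h3⟩ := hSG i j hij
      exact card_pos.mpr ⟨k, by simp [hK, h1, h2, h3]⟩
    rw [← Finset.sum_filter]
    have hconst : ∀ τ ∈ T.filter (fun τ => i ∈ τ ∧ j ∈ τ), w τ = 1 / (#K : ℝ) := by
      intro τ hτ
      rw [mem_filter] at hτ
      simp only [w]
      rw [← hline τ hτ.1 i hτ.2.1 j hτ.2.2 hij, hN2 i j hij]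
      push_cast
      rw [add_sub_cancel_right]
    rw [Finset.sum_congr rfl hconst, Finset.sum_const, hfilter, hcardK, nsmul_eq_mul]
    have : (#K : ℝ) ≠ 0 := by exact_mod_cast hKpos.ne'
    field_simp

/-- Kelly's theorem: the span of a finite complex Sylvester–Gallai configuration has dimension
at most three. -/
theorem kelly {κ E : Type*} [Finite κ] [AddCommGroup E] [Module ℂ E] (v : κ → E)
    (h : ∀ i j, LinearIndependent ℂ ![v i, v j] →
      ∃ k, ∃ s t : ℂ, s ≠ 0 ∧ t ≠ 0 ∧ v k = s • v i + t • v j) :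
    Module.finrank ℂ (Submodule.span ℂ (Set.range v)) ≤ 3 := by
  classical
  let pt : {k // v k ≠ 0} → Projectivization ℂ E := fun k => Projectivization.mk ℂ (v k) k.2
  let P : Set (Projectivization ℂ E) := Set.range pt
  have : Fintype P := (Set.finite_range pt).fintype
  have hrep : ∀ p : P, ∃ k, pt k = p := fun p => p.2
  choose rep hrep using hrep
  let u : P → E := fun p => v (rep p)
  have hmul : ∀ k (hk : v k ≠ 0), ∃ p : P, ∃ a : ℂ, a • u p = v k := by
    intro k hk
    refine ⟨⟨pt ⟨k, hk⟩, ⟨k, hk⟩, rfl⟩, ?_⟩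
    have := (hrep ⟨pt ⟨k, hk⟩, ⟨k, hk⟩, rfl⟩).symm
    exact (Projectivization.mk_eq_mk_iff' ℂ _ _ _ _).mp this
  have hli : ∀ p q : P, p ≠ q → LinearIndependent ℂ ![u p, u q] := by
    intro p q hpq
    rw [LinearIndependent.pair_iff' (rep p).2]
    intro a ha
    refine hpq (Subtype.ext ?_)
    rw [← hrep p, ← hrep q]
    exact ((Projectivization.mk_eq_mk_iff' ℂ _ _ (rep q).2 (rep p).2).mpr ⟨a, ha⟩).symm
  have hspan : Submodule.span ℂ (Set.range v) ≤ Submodule.span ℂ (Set.range u) := by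
    refine Submodule.span_le.mpr ?_
    rintro _ ⟨k, rfl⟩
    by_cases hk : v k = 0
    · rw [hk]; exact Submodule.zero_mem _
    · obtain ⟨p, a, ha⟩ := hmul k hk
      rw [← ha]
      exact Submodule.smul_mem _ _ (Submodule.subset_span ⟨p, rfl⟩)
  have : FiniteDimensional ℂ (Submodule.span ℂ (Set.range u)) :=
    FiniteDimensional.span_of_finite ℂ (Set.finite_range u)
  refine (Submodule.finrank_mono hspan).trans (finrank_span_le_three_of_pairwise u hli ?_)
  intro p q hpq
  obtain ⟨k, s, t, hs, ht, hk⟩ := h (rep p) (rep q) (hli p q hpq)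
  have hind := LinearIndependent.pair_iff.mp (hli p q hpq)
  have hk0 : v k ≠ 0 := by
    intro h0
    exact hs (hind s t (by rw [← h0, hk])).1
  obtain ⟨x, a, ha⟩ := hmul k hk0
  have ha0 : a ≠ 0 := by rintro rfl; simp at ha; exact hk0 ha.symm
  have hax : a • u x = s • u p + t • u q := ha.trans hk
  refine ⟨x, ?_, ?_, ?_⟩
  · rintro rfl
    refine ht (hind (s - a) t ?_).2
    rw [sub_smul, hax]; abel
  · rintro rfl
    refine hs (hind s (t - a) ?_).1
    rw [sub_smul, hax]; abel
  · refine Submodule.mem_span_pair.mpr ⟨a⁻¹ * s, a⁻¹ * t, ?_⟩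
    rw [mul_smul, mul_smul, ← smul_add, ← hax, smul_smul, inv_mul_cancel₀ ha0, one_smul]

open Module in
theorem exists_forall_apply_eq {E ι : Type*} [Fintype ι] [AddCommGroup E] [Module ℂ E]
    (f : ι → Dual ℂ E) (t : ι → ℂ)
    (h : ∀ c : ι → ℂ, ∑ i, c i • f i = 0 → ∑ i, c i * t i = 0) : ∃ p, ∀ i, f i p = t i := by
  classical
  by_contra hne
  push Not at hne
  have hmem : t ∉ LinearMap.range (LinearMap.pi f) := by
    rintro ⟨p, hp⟩
    obtain ⟨i, hi⟩ := hne p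
    exact hi (congrFun hp i)
  obtain ⟨g, hgt, hg⟩ := Submodule.exists_le_ker_of_notMem hmem
  have hexp : ∀ u : ι → ℂ, g u = ∑ i, g (Pi.single i 1) * u i := by
    intro u
    conv_lhs => rw [pi_eq_sum_univ' u]
    simp [map_sum, mul_comm]
  refine hgt ?_
  rw [hexp]
  refine h _ (LinearMap.ext fun p => ?_)
  have := hg ⟨p, rfl⟩
  rw [LinearMap.mem_ker, hexp] at this
  simpa using this

open Module in
theorem exists_apply_eq_four {E : Type*} [AddCommGroup E] [Module ℂ E]
    (x y x' y' : Dual ℂ E) (s t s' t' : ℂ)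
    (h : ∀ c₁ c₂ c₃ c₄ : ℂ, c₁ • x + c₂ • y + c₃ • x' + c₄ • y' = 0 →
      c₁ * s + c₂ * t + c₃ * s' + c₄ * t' = 0) :
    ∃ p, x p = s ∧ y p = t ∧ x' p = s' ∧ y' p = t' := by
  obtain ⟨p, hp⟩ := exists_forall_apply_eq ![x, y, x', y'] ![s, t, s', t'] (fun c hc => by
    simpa [Fin.sum_univ_four] using
      h (c 0) (c 1) (c 2) (c 3) (by simpa [Fin.sum_univ_four] using hc))
  exact ⟨p, hp 0, hp 1, hp 2, hp 3⟩

open Module in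
theorem exists_eq_combination_of_vanish {E : Type*} [AddCommGroup E] [Module ℂ E]
    (x y x' y' z : Dual ℂ E)
    (h : ∀ p, x p = 0 → y p = 0 → x' p = 0 → y' p = 0 → z p = 0) :
    ∃ c₁ c₂ c₃ c₄ : ℂ, z = c₁ • x + c₂ • y + c₃ • x' + c₄ • y' := by
  have : z ∈ Submodule.span ℂ (Set.range ![x, y, x', y']) := by
    refine mem_span_of_iInf_ker_le_ker fun p hp => ?_
    simp only [Submodule.mem_iInf, LinearMap.mem_ker] at hp
    exact h p (hp 0) (hp 1) (hp 2) (hp 3)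
  obtain ⟨c, hc⟩ := (Submodule.mem_span_range_iff_exists_fun ℂ).mp this
  exact ⟨c 0, c 1, c 2, c 3, by rw [← hc]; simp [Fin.sum_univ_four]⟩

theorem eq_zero_of_infinite_quartic_roots {S : Set ℂ} (hS : S.Infinite) (c₀ c₁ c₂ c₃ c₄ : ℂ)
    (h : ∀ t ∈ S, c₀ + c₁ * t + c₂ * t ^ 2 + c₃ * t ^ 3 + c₄ * t ^ 4 = 0) :
    c₀ = 0 ∧ c₁ = 0 ∧ c₂ = 0 ∧ c₃ = 0 ∧ c₄ = 0 := by
  let P : Polynomial ℂ := .C c₀ + .C c₁ * .X + .C c₂ * .X ^ 2 + .C c₃ * .X ^ 3 + .C c₄ * .X ^ 4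
  have hP : P = 0 := Polynomial.eq_zero_of_infinite_isRoot P
    (hS.mono fun t ht => by simpa [P, Polynomial.IsRoot] using h t ht)
  have hc : ∀ n, P.coeff n = 0 := by simp [hP]
  refine ⟨?_, ?_, ?_, ?_, ?_⟩
  · simpa [P, Polynomial.coeff_X, Polynomial.coeff_X_pow] using hc 0
  · simpa [P, Polynomial.coeff_X, Polynomial.coeff_C, Polynomial.coeff_X_pow] using hc 1
  · simpa [P, Polynomial.coeff_X, Polynomial.coeff_C, Polynomial.coeff_X_pow] using hc 2
  · simpa [P, Polynomial.coeff_X, Polynomial.coeff_C, Polynomial.coeff_X_pow] using hc 3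
  · simpa [P, Polynomial.coeff_X, Polynomial.coeff_C, Polynomial.coeff_X_pow] using hc 4

open Module in
/-- A family of pairs of linear functionals `a k, b k` on `E` whose products are nonzero and
pairwise distinct, such that on each codimension-two subspace where the `i`-th and `j`-th products
agree they vanish, or a third product agrees with them or vanishes. -/
structure IsProductConfiguration {E ι : Type*} [AddCommGroup E] [Module ℂ E]
    (a b : ι → Dual ℂ E) : Prop where
  left_ne_zero : ∀ k, a k ≠ 0
  right_ne_zero : ∀ k, b k ≠ 0
  mul_ne_mul : ∀ i j, i ≠ j → ¬ ∀ p, a i p * b i p = a j p * b j p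
  exists_third : ∀ (c d : Dual ℂ E) (i j : ι), i ≠ j →
    (∀ p, c p = 0 → d p = 0 → a i p * b i p = a j p * b j p) →
    (∀ p, c p = 0 → d p = 0 → a i p * b i p = 0) ∨
    ∃ k, k ≠ i ∧ k ≠ j ∧ ((∀ p, c p = 0 → d p = 0 → a k p * b k p = a i p * b i p) ∨
      (∀ p, c p = 0 → d p = 0 → a k p * b k p = 0))

open Module in
theorem forall_mem_eq_zero_or_of_mul_eq_zero {E : Type*} [AddCommGroup E] [Module ℂ E]
    (c d x y : Dual ℂ E) (h : ∀ p, c p = 0 → d p = 0 → x p * y p = 0) :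
    (∀ p, c p = 0 → d p = 0 → x p = 0) ∨ (∀ p, c p = 0 → d p = 0 → y p = 0) := by
  by_contra! hne
  obtain ⟨⟨p, hcp, hdp, hxp⟩, q, hcq, hdq, hyq⟩ := hne
  have hp := (mul_eq_zero.mp (h p hcp hdp)).resolve_left hxp
  have hq := (mul_eq_zero.mp (h q hcq hdq)).resolve_right hyq
  have := h (p + q) (by simp [hcp, hcq]) (by simp [hdp, hdq])
  simp [hp, hq, hxp, hyq] at this

namespace IsProductConfiguration

open Module

variable {E ι : Type*} [AddCommGroup E] [Module ℂ E] {a b : ι → Dual ℂ E}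

theorem exists_infinite_ruling [Finite ι] (hC : IsProductConfiguration a b) {i j : ι}
    (hij : i ≠ j) {x y x' y' : Dual ℂ E} (hxy : ∀ p, x p * y p = a i p * b i p)
    (hxy' : ∀ p, x' p * y' p = a j p * b j p) :
    ∃ S : Set ℂ, S.Infinite ∧
      ((∀ t ∈ S, ∀ p, x p = t * x' p → y' p = t * y p → x p * y p = 0) ∨
      ∃ k, k ≠ i ∧ k ≠ j ∧
        ((∀ t ∈ S, ∀ p, x p = t * x' p → y' p = t * y p → a k p * b k p = x p * y p) ∨
        ∃ z, (z = a k ∨ z = b k) ∧ ∀ t ∈ S, ∀ p, x p = t * x' p → y' p = t * y p → z p = 0)) := by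
  classical
  have key : ∀ t : ℂ, ∃ o : Unit ⊕ ι ⊕ ι ⊕ ι,
      ∀ p, x p = t * x' p → y' p = t * y p →
        Sum.elim (fun _ => x p * y p = 0)
          (Sum.elim (fun k => k ≠ i ∧ k ≠ j ∧ a k p * b k p = x p * y p)
          (Sum.elim (fun k => k ≠ i ∧ k ≠ j ∧ a k p = 0)
            (fun k => k ≠ i ∧ k ≠ j ∧ b k p = 0))) o := by
    intro t
    have hmem : ∀ p, (x - t • x') p = 0 ∧ (y' - t • y) p = 0 ↔ x p = t * x' p ∧ y' p = t * y p := by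
      intro p
      simp [sub_eq_zero]
    have := hC.exists_third (x - t • x') (y' - t • y) i j hij (fun p h1 h2 => by
      obtain ⟨h1, h2⟩ := (hmem p).mp ⟨h1, h2⟩
      rw [← hxy, ← hxy', h1, h2]; ring)
    rcases this with h | ⟨k, hki, hkj, h | h⟩
    · refine ⟨.inl (), fun p h1 h2 => ?_⟩
      obtain ⟨h1, h2⟩ := (hmem p).mpr ⟨h1, h2⟩
      simpa [hxy] using h p h1 h2
    · refine ⟨.inr (.inl k), fun p h1 h2 => ?_⟩
      obtain ⟨h1, h2⟩ := (hmem p).mpr ⟨h1, h2⟩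
      simpa [hxy, hki, hkj] using h p h1 h2
    · rcases forall_mem_eq_zero_or_of_mul_eq_zero _ _ _ _ h with h | h
      · refine ⟨.inr (.inr (.inl k)), fun p h1 h2 => ?_⟩
        obtain ⟨h1, h2⟩ := (hmem p).mpr ⟨h1, h2⟩
        simpa [hki, hkj] using h p h1 h2
      · refine ⟨.inr (.inr (.inr k)), fun p h1 h2 => ?_⟩
        obtain ⟨h1, h2⟩ := (hmem p).mpr ⟨h1, h2⟩
        simpa [hki, hkj] using h p h1 h2
  choose o ho using key
  obtain ⟨v, hv⟩ := Finite.exists_infinite_fiber o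
  refine ⟨o ⁻¹' {v}, Set.infinite_coe_iff.mp hv, ?_⟩
  obtain ⟨t₀, ht₀⟩ := (Set.infinite_coe_iff.mp hv).nonempty
  have ho' : ∀ t ∈ o ⁻¹' {v}, ∀ p, _ := fun t ht p => by
    have := ho t p
    rwa [show o t = v from ht] at this
  have h00 := ho' t₀ ht₀ 0 (by simp) (by simp)
  rcases v with _ | k | k | k
  · exact .inl ho'
  · exact .inr ⟨k, h00.1, h00.2.1, .inl fun t ht p h1 h2 => (ho' t ht p h1 h2).2.2⟩
  · exact .inr ⟨k, h00.1, h00.2.1,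
      .inr ⟨_, .inl rfl, fun t ht p h1 h2 => (ho' t ht p h1 h2).2.2⟩⟩
  · exact .inr ⟨k, h00.1, h00.2.1,
      .inr ⟨_, .inr rfl, fun t ht p h1 h2 => (ho' t ht p h1 h2).2.2⟩⟩

theorem vanish_of_ruling_eq {u v x y x' y' : Dual ℂ E} {t : ℂ} {p q : E}
    (h : ∀ p, x p = t * x' p → y' p = t * y p → u p * v p = x p * y p)
    (hp : x p = t * x' p) (hp' : y' p = t * y p) (hne : x p * y p ≠ 0)
    (h1 : x q = 0) (h2 : y q = 0) (h3 : x' q = 0) (h4 : y' q = 0) : u q = 0 ∧ v q = 0 := by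
  have e0 := h p hp hp'
  have e1 := h (p + q) (by simp [h1, h3, hp]) (by simp [h2, h4, hp'])
  have e2 := h (p - q) (by simp [h1, h3, hp]) (by simp [h2, h4, hp'])
  simp only [map_add, map_sub, h1, h2, add_zero, sub_zero] at e1 e2
  have hu : u p ≠ 0 := by intro h0; rw [h0, zero_mul] at e0; exact hne e0.symm
  have hv : v p ≠ 0 := by intro h0; rw [h0, mul_zero] at e0; exact hne e0.symm
  have f1 : u q * v q = 0 := by linear_combination (e1 + e2) / 2 - e0
  have f2 : u p * v q + u q * v p = 0 := by linear_combination (e1 - e2) / 2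
  rcases mul_eq_zero.mp f1 with h0 | h0
  · refine ⟨h0, ?_⟩
    rw [h0, zero_mul, add_zero] at f2
    exact (mul_eq_zero.mp f2).resolve_left hu
  · refine ⟨?_, h0⟩
    rw [h0, mul_zero, zero_add] at f2
    exact (mul_eq_zero.mp f2).resolve_right hv

theorem ne_zero_of_eq_or_eq (hC : IsProductConfiguration a b) {k : ι} {z : Dual ℂ E}
    (hz : z = a k ∨ z = b k) : z ≠ 0 := by
  rcases hz with rfl | rfl
  exacts [hC.left_ne_zero k, hC.right_ne_zero k]

theorem exists_relation [Finite ι] (hC : IsProductConfiguration a b) {i j : ι} (hij : i ≠ j) :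
    ∃ c₁ c₂ c₃ c₄ : ℂ, c₁ • a i + c₂ • b i + c₃ • a j + c₄ • b j = 0 ∧
      ¬ (c₁ = 0 ∧ c₂ = 0 ∧ c₃ = 0 ∧ c₄ = 0) := by
  by_contra! hind
  have hpt : ∀ l s t : ℂ, ∃ p, a i p = l * s ∧ b i p = t ∧ a j p = s ∧ b j p = l * t :=
    fun l s t => exists_apply_eq_four _ _ _ _ _ _ _ _ fun c₁ c₂ c₃ c₄ hc => by
      obtain ⟨rfl, rfl, rfl, rfl⟩ := hind c₁ c₂ c₃ c₄ hc
      ring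
  obtain ⟨S, hS, h⟩ := hC.exists_infinite_ruling hij (x := a i) (y := b i) (x' := a j) (y' := b j)
    (fun _ => rfl) (fun _ => rfl)
  obtain ⟨l₀, hl₀, hl₀0⟩ := (hS.sdiff (Set.finite_singleton 0)).nonempty
  rw [Set.mem_singleton_iff] at hl₀0
  rcases h with h | ⟨k, hki, hkj, h | ⟨z, hz, h⟩⟩
  · obtain ⟨p, h1, h2, h3, h4⟩ := hpt l₀ 1 1
    have := h l₀ hl₀ p (by rw [h1, h3]) (by rw [h2, h4])
    rw [h1, h2] at this
    simp [hl₀0] at this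
  · obtain ⟨p, h1, h2, h3, h4⟩ := hpt l₀ 1 1
    have hvan := fun q => vanish_of_ruling_eq (q := q) (h l₀ hl₀) (p := p) (by rw [h1, h3])
      (by rw [h2, h4]) (by rw [h1, h2]; simp [hl₀0])
    obtain ⟨u₁, u₂, u₃, u₄, hu⟩ := exists_eq_combination_of_vanish _ _ _ _ (a k)
      (fun q g1 g2 g3 g4 => (hvan q g1 g2 g3 g4).1)
    obtain ⟨v₁, v₂, v₃, v₄, hv⟩ := exists_eq_combination_of_vanish _ _ _ _ (b k)
      (fun q g1 g2 g3 g4 => (hvan q g1 g2 g3 g4).2)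
    have heq : ∀ l ∈ S, ∀ s t, (u₁ * (l * s) + u₂ * t + u₃ * s + u₄ * (l * t)) *
        (v₁ * (l * s) + v₂ * t + v₃ * s + v₄ * (l * t)) = l * s * t := by
      intro l hl s t
      obtain ⟨p, h1, h2, h3, h4⟩ := hpt l s t
      have := h l hl p (by rw [h1, h3]) (by rw [h2, h4])
      rw [hu, hv] at this
      simpa [h1, h2, h3, h4] using this
    obtain ⟨p0, p1, p2, -, -⟩ := eq_zero_of_infinite_quartic_roots hS (u₃ * v₃)
      (u₁ * v₃ + u₃ * v₁) (u₁ * v₁) 0 0 (fun l hl => by linear_combination heq l hl 1 0)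
    obtain ⟨q0, q1, q2, -, -⟩ := eq_zero_of_infinite_quartic_roots hS (u₂ * v₂)
      (u₂ * v₄ + u₄ * v₂) (u₄ * v₄) 0 0 (fun l hl => by linear_combination heq l hl 0 1)
    obtain ⟨r0, r1, r2, -, -⟩ := eq_zero_of_infinite_quartic_roots hS (u₂ * v₃ + u₃ * v₂)
      (u₁ * v₂ + u₂ * v₁ + u₃ * v₄ + u₄ * v₃ - 1) (u₁ * v₄ + u₄ * v₁) 0 0
      (fun l hl => by
        linear_combination heq l hl 1 1 - heq l hl 1 0 - heq l hl 0 1)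
    have hprod : (u₁ * v₂ + u₂ * v₁ = 1 ∧ u₃ * v₄ + u₄ * v₃ = 0) ∨
        (u₁ * v₂ + u₂ * v₁ = 0 ∧ u₃ * v₄ + u₄ * v₃ = 1) := by
      have hp : (u₁ = 0 ∧ u₃ = 0) ∨ (v₁ = 0 ∧ v₃ = 0) := by grind
      have hq : (u₂ = 0 ∧ u₄ = 0) ∨ (v₂ = 0 ∧ v₄ = 0) := by grind
      grind
    rcases hprod with ⟨g1, g2⟩ | ⟨g1, g2⟩
    · refine hC.mul_ne_mul k i hki fun p => ?_
      rw [hu, hv]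
      simp only [LinearMap.add_apply, LinearMap.smul_apply, smul_eq_mul]
      linear_combination (a i p) ^ 2 * p2 + (b i p) ^ 2 * q0 + (a j p) ^ 2 * p0 +
        (b j p) ^ 2 * q2 + a i p * a j p * p1 + b i p * b j p * q1 + b i p * a j p * r0 +
        a i p * b j p * r2 + a i p * b i p * g1 + a j p * b j p * g2
    · refine hC.mul_ne_mul k j hkj fun p => ?_
      rw [hu, hv]
      simp only [LinearMap.add_apply, LinearMap.smul_apply, smul_eq_mul]
      linear_combination (a i p) ^ 2 * p2 + (b i p) ^ 2 * q0 + (a j p) ^ 2 * p0 +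
        (b j p) ^ 2 * q2 + a i p * a j p * p1 + b i p * b j p * q1 + b i p * a j p * r0 +
        a i p * b j p * r2 + a i p * b i p * g1 + a j p * b j p * g2
  · obtain ⟨u₁, u₂, u₃, u₄, hu⟩ := exists_eq_combination_of_vanish (a i) (b i) (a j) (b j) z
      (fun q g1 g2 g3 g4 => h l₀ hl₀ q (by simp [g1, g3]) (by simp [g2, g4]))
    have heq : ∀ l ∈ S, ∀ s t, u₁ * (l * s) + u₂ * t + u₃ * s + u₄ * (l * t) = 0 := by
      intro l hl s t
      obtain ⟨p, h1, h2, h3, h4⟩ := hpt l s t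
      have := h l hl p (by rw [h1, h3]) (by rw [h2, h4])
      rw [hu] at this
      simpa [h1, h2, h3, h4] using this
    obtain ⟨p0, p1, -⟩ := eq_zero_of_infinite_quartic_roots hS u₃ u₁ 0 0 0
      (fun l hl => by linear_combination heq l hl 1 0)
    obtain ⟨q0, q1, -⟩ := eq_zero_of_infinite_quartic_roots hS u₂ u₄ 0 0 0
      (fun l hl => by linear_combination heq l hl 0 1)
    refine hC.ne_zero_of_eq_or_eq hz ?_
    rw [hu, p0, p1, q0, q1]
    simp

theorem mem_span_pair_of_parallel [Finite ι] (hC : IsProductConfiguration a b) {i j : ι}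
    (hij : i ≠ j) {c : ℂ} (hc : b i = c • a i) (hj : LinearIndependent ℂ ![a j, b j]) :
    a i ∈ Submodule.span ℂ {a j, b j} := by
  by_contra hmem
  have hc0 : c ≠ 0 := by
    rintro rfl
    exact hC.right_ne_zero i (by rw [hc, zero_smul])
  have hind : ∀ c₁ c₃ c₄ : ℂ, c₁ • a i + c₃ • a j + c₄ • b j = 0 → c₁ = 0 ∧ c₃ = 0 ∧ c₄ = 0 := by
    intro c₁ c₃ c₄ h
    have h1 : c₁ = 0 := by
      by_contra h1
      refine hmem (Submodule.mem_span_pair.mpr ⟨-c₁⁻¹ * c₃, -c₁⁻¹ * c₄, ?_⟩)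
      have : a i = c₁⁻¹ • (c₁ • a i) := by rw [smul_smul, inv_mul_cancel₀ h1, one_smul]
      have h' : c₁ • a i = -(c₃ • a j + c₄ • b j) :=
        eq_neg_of_add_eq_zero_left (by rw [← add_assoc]; exact h)
      rw [this, h']
      module
    subst h1
    exact ⟨rfl, LinearIndependent.pair_iff.mp hj c₃ c₄ (by simpa using h)⟩
  have hpt : ∀ l : ℂ, ∃ p, a i p = l ∧ b i p = c * l ∧ a j p = 1 ∧ b j p = c * l ^ 2 :=
    fun l => exists_apply_eq_four _ _ _ _ _ _ _ _ fun c₁ c₂ c₃ c₄ h => by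
      obtain ⟨h1, rfl, rfl⟩ := hind (c₁ + c₂ * c) c₃ c₄ (by rw [← h, hc]; module)
      linear_combination l * h1
  obtain ⟨S, hS, h⟩ := hC.exists_infinite_ruling hij (x := a i) (y := b i) (x' := a j) (y' := b j)
    (fun _ => rfl) (fun _ => rfl)
  obtain ⟨l₀, hl₀, hl₀0⟩ := (hS.sdiff (Set.finite_singleton 0)).nonempty
  rw [Set.mem_singleton_iff] at hl₀0
  have hcomb : ∀ (z : Dual ℂ E) (u₁ u₂ u₃ u₄ : ℂ),
      z = u₁ • a i + u₂ • b i + u₃ • a j + u₄ • b j →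
      ∃ u v w : ℂ, z = u • a i + v • a j + w • b j := by
    rintro z u₁ u₂ u₃ u₄ rfl
    exact ⟨u₁ + u₂ * c, u₃, u₄, by rw [hc]; module⟩
  rcases h with h | ⟨k, hki, hkj, h | ⟨z, hz, h⟩⟩
  · obtain ⟨p, h1, h2, h3, h4⟩ := hpt l₀
    have := h l₀ hl₀ p (by rw [h1, h3, mul_one]) (by rw [h2, h4]; ring)
    rw [h1, h2] at this
    simp [hl₀0, hc0] at this
  · obtain ⟨p, h1, h2, h3, h4⟩ := hpt l₀
    have hvan := fun q => vanish_of_ruling_eq (q := q) (h l₀ hl₀) (p := p) (by rw [h1, h3, mul_one])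
      (by rw [h2, h4]; ring) (by rw [h1, h2]; simp [hl₀0, hc0])
    obtain ⟨_, _, _, _, hu⟩ := exists_eq_combination_of_vanish _ _ _ _ (a k)
      (fun q g1 g2 g3 g4 => (hvan q g1 g2 g3 g4).1)
    obtain ⟨_, _, _, _, hv⟩ := exists_eq_combination_of_vanish _ _ _ _ (b k)
      (fun q g1 g2 g3 g4 => (hvan q g1 g2 g3 g4).2)
    obtain ⟨u₁, u₂, u₃, hu⟩ := hcomb _ _ _ _ _ hu
    obtain ⟨v₁, v₂, v₃, hv⟩ := hcomb _ _ _ _ _ hv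
    have heq : ∀ l ∈ S, (u₁ * l + u₂ + u₃ * (c * l ^ 2)) * (v₁ * l + v₂ + v₃ * (c * l ^ 2)) =
        l * (c * l) := by
      intro l hl
      obtain ⟨p, h1, h2, h3, h4⟩ := hpt l
      have := h l hl p (by rw [h1, h3, mul_one]) (by rw [h2, h4]; ring)
      rw [hu, hv] at this
      simpa [h1, h2, h3, h4] using this
    obtain ⟨p0, p1, p2, p3, p4⟩ := eq_zero_of_infinite_quartic_roots hS (u₂ * v₂)
      (u₁ * v₂ + u₂ * v₁) (u₁ * v₁ + c * (u₂ * v₃ + u₃ * v₂) - c) (c * (u₁ * v₃ + u₃ * v₁))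
      (c ^ 2 * (u₃ * v₃)) (fun l hl => by linear_combination heq l hl)
    simp only [mul_eq_zero, hc0, false_or, pow_eq_zero_iff, ne_eq, OfNat.ofNat_ne_zero,
      not_false_eq_true] at p3 p4
    have hprod : (u₁ * v₁ = c ∧ u₂ * v₃ + u₃ * v₂ = 0) ∨
        (u₁ * v₁ = 0 ∧ u₂ * v₃ + u₃ * v₂ = 1) := by
      grind
    rw [← mul_eq_zero] at p4
    rcases hprod with ⟨g1, g2⟩ | ⟨g1, g2⟩
    · refine hC.mul_ne_mul k i hki fun p => ?_
      rw [hu, hv, hc]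
      simp only [LinearMap.add_apply, LinearMap.smul_apply, smul_eq_mul]
      linear_combination (a i p) ^ 2 * g1 + (a j p) ^ 2 * p0 + (b j p) ^ 2 * p4 +
        a i p * a j p * p1 + a i p * b j p * p3 + a j p * b j p * g2
    · refine hC.mul_ne_mul k j hkj fun p => ?_
      rw [hu, hv]
      simp only [LinearMap.add_apply, LinearMap.smul_apply, smul_eq_mul]
      linear_combination (a i p) ^ 2 * g1 + (a j p) ^ 2 * p0 + (b j p) ^ 2 * p4 +
        a i p * a j p * p1 + a i p * b j p * p3 + a j p * b j p * g2
  · obtain ⟨_, _, _, _, hu⟩ := exists_eq_combination_of_vanish (a i) (b i) (a j) (b j) z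
      (fun q g1 g2 g3 g4 => h l₀ hl₀ q (by simp [g1, g3]) (by simp [g2, g4]))
    obtain ⟨u₁, u₂, u₃, hu⟩ := hcomb _ _ _ _ _ hu
    obtain ⟨p0, p1, p2, -⟩ := eq_zero_of_infinite_quartic_roots hS u₂ u₁ (u₃ * c) 0 0
      (fun l hl => by
        obtain ⟨p, h1, h2, h3, h4⟩ := hpt l
        have := h l hl p (by rw [h1, h3, mul_one]) (by rw [h2, h4]; ring)
        rw [hu] at this
        simp only [LinearMap.add_apply, LinearMap.smul_apply, smul_eq_mul, h1, h3, h4] at this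
        linear_combination this)
    refine hC.ne_zero_of_eq_or_eq hz ?_
    rw [hu, p0, p1, (mul_eq_zero.mp p2).resolve_right hc0]
    simp

theorem eq_zero_of_conic_form_eq_zero {S : Set ℂ} (hS : S.Infinite) {α β γ δ : ℂ}
    (h1 : ¬ (α = 0 ∧ β = 0)) (h2 : ¬ (γ = 0 ∧ δ = 0)) (h3 : ¬ (α = 0 ∧ γ = 0))
    (h4 : ¬ (β = 0 ∧ δ = 0)) (r s t : ℂ)
    (h : ∀ l ∈ S, r * (l * (β + δ * l)) ^ 2 + s * (l * (β + δ * l) * -(α * l + γ)) +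
      t * (α * l + γ) ^ 2 = 0) : r = 0 ∧ s = 0 ∧ t = 0 := by
  obtain ⟨p0, p1, p2, p3, p4⟩ := eq_zero_of_infinite_quartic_roots hS (t * γ ^ 2)
    (2 * t * α * γ - s * β * γ) (r * β ^ 2 - s * (β * α + δ * γ) + t * α ^ 2)
    (2 * r * β * δ - s * δ * α) (r * δ ^ 2) (fun l hl => by linear_combination h l hl)
  by_cases hγ : γ = 0 <;> by_cases hβ : β = 0 <;> simp_all

theorem exists_mem_sup_of_conic [Finite ι] (hC : IsProductConfiguration a b) {i j : ι}
    (hij : i ≠ j) {x y x' y' : Dual ℂ E} (hxy : ∀ p, x p * y p = a i p * b i p)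
    (hxy' : ∀ p, x' p * y' p = a j p * b j p) {α β γ δ : ℂ}
    (hrel : ∀ c₁ c₂ c₃ c₄ : ℂ, c₁ • x + c₂ • y + c₃ • x' + c₄ • y' = 0 →
      ∃ t, c₁ = t * α ∧ c₂ = t * β ∧ c₃ = t * γ ∧ c₄ = t * δ)
    (h1 : ¬ (α = 0 ∧ β = 0)) (h2 : ¬ (γ = 0 ∧ δ = 0)) (h3 : ¬ (α = 0 ∧ γ = 0))
    (h4 : ¬ (β = 0 ∧ δ = 0)) :
    ∃ k, (∃ z, (z = a k ∨ z = b k) ∧ z ∈ Submodule.span ℂ {x, y} ⊔ Submodule.span ℂ {x', y'} ∧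
        z ∉ Submodule.span ℂ {x, y} ∧ z ∉ Submodule.span ℂ {x', y'}) ∨
      (a k ∈ Submodule.span ℂ {x, y} ⊔ Submodule.span ℂ {x', y'} ∧
        b k ∈ Submodule.span ℂ {x, y} ⊔ Submodule.span ℂ {x', y'} ∧
        ¬ (a k ∈ Submodule.span ℂ {x, y} ∧ b k ∈ Submodule.span ℂ {x, y}) ∧
        ¬ (a k ∈ Submodule.span ℂ {x', y'} ∧ b k ∈ Submodule.span ℂ {x', y'})) := by
  have hpt : ∀ l : ℂ, ∃ p, x p = l * (β + δ * l) ∧ y p = -(α * l + γ) ∧ x' p = β + δ * l ∧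
      y' p = l * -(α * l + γ) :=
    fun l => exists_apply_eq_four _ _ _ _ _ _ _ _ fun c₁ c₂ c₃ c₄ h => by
      obtain ⟨t, rfl, rfl, rfl, rfl⟩ := hrel c₁ c₂ c₃ c₄ h
      ring
  obtain ⟨S, hS, h⟩ := hC.exists_infinite_ruling hij hxy hxy'
  have hform := fun r s t => eq_zero_of_conic_form_eq_zero hS h1 h2 h3 h4 r s t
  have hform' := fun r s t => eq_zero_of_conic_form_eq_zero hS (α := -δ) (β := -γ) (γ := -β)
    (δ := -α) (by simpa [and_comm] using h2) (by simpa [and_comm] using h1)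
    (by simpa [and_comm] using h4) (by simpa [and_comm] using h3) r s t
  have hmem : ∀ z : Dual ℂ E, (∃ u₁ u₂ u₃ u₄ : ℂ, z = u₁ • x + u₂ • y + u₃ • x' + u₄ • y') →
      z ∈ Submodule.span ℂ {x, y} ⊔ Submodule.span ℂ {x', y'} := by
    rintro z ⟨u₁, u₂, u₃, u₄, rfl⟩
    rw [add_assoc]
    exact Submodule.add_mem_sup (Submodule.mem_span_pair.mpr ⟨_, _, rfl⟩)
      (Submodule.mem_span_pair.mpr ⟨_, _, rfl⟩)
  rcases h with h | ⟨k, hki, hkj, h | ⟨z, hz, h⟩⟩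
  · have := hform 0 1 0 fun l hl => by
      obtain ⟨p, e1, e2, e3, e4⟩ := hpt l
      have := h l hl p (by rw [e1, e3]) (by rw [e2, e4])
      rw [e1, e2] at this
      linear_combination this
    simp at this
  · obtain ⟨l₀, hl₀, hl₀0⟩ : ∃ l ∈ S, l * (β + δ * l) * -(α * l + γ) ≠ 0 := by
      by_contra! hcon
      have := hform 0 1 0 fun l hl => by linear_combination hcon l hl
      simp at this
    obtain ⟨p, e1, e2, e3, e4⟩ := hpt l₀
    have hvan := fun q => vanish_of_ruling_eq (q := q) (h l₀ hl₀) (p := p) (by rw [e1, e3])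
      (by rw [e2, e4]) (by rwa [e1, e2])
    refine ⟨k, .inr ⟨hmem _ (exists_eq_combination_of_vanish _ _ _ _ (a k)
      (fun q g1 g2 g3 g4 => (hvan q g1 g2 g3 g4).1)),
      hmem _ (exists_eq_combination_of_vanish _ _ _ _ (b k)
      (fun q g1 g2 g3 g4 => (hvan q g1 g2 g3 g4).2)), ?_, ?_⟩⟩
    · rintro ⟨ha, hb⟩
      obtain ⟨u, v, huv⟩ := Submodule.mem_span_pair.mp ha
      obtain ⟨u', v', huv'⟩ := Submodule.mem_span_pair.mp hb
      obtain ⟨g1, g2, g3⟩ := hform (u * u') (u * v' + v * u' - 1) (v * v') fun l hl => by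
        obtain ⟨p, e1, e2, e3, e4⟩ := hpt l
        have := h l hl p (by rw [e1, e3]) (by rw [e2, e4])
        rw [← huv, ← huv'] at this
        simp only [LinearMap.add_apply, LinearMap.smul_apply, smul_eq_mul, e1, e2] at this
        linear_combination this
      refine hC.mul_ne_mul k i hki fun p => ?_
      rw [← hxy, ← huv, ← huv']
      simp only [LinearMap.add_apply, LinearMap.smul_apply, smul_eq_mul]
      linear_combination (x p) ^ 2 * g1 + x p * y p * g2 + (y p) ^ 2 * g3
    · rintro ⟨ha, hb⟩
      obtain ⟨u, v, huv⟩ := Submodule.mem_span_pair.mp ha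
      obtain ⟨u', v', huv'⟩ := Submodule.mem_span_pair.mp hb
      obtain ⟨g1, g2, g3⟩ := hform' (v * v') (u * v' + v * u' - 1) (u * u') fun l hl => by
        obtain ⟨p, e1, e2, e3, e4⟩ := hpt l
        have := h l hl p (by rw [e1, e3]) (by rw [e2, e4])
        rw [← huv, ← huv'] at this
        simp only [LinearMap.add_apply, LinearMap.smul_apply, smul_eq_mul, e1, e2, e3, e4] at this
        linear_combination this
      refine hC.mul_ne_mul k j hkj fun p => ?_
      rw [← hxy', ← huv, ← huv']
      simp only [LinearMap.add_apply, LinearMap.smul_apply, smul_eq_mul]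
      linear_combination (x' p) ^ 2 * g3 + x' p * y' p * g2 + (y' p) ^ 2 * g1
  · have hz0 := hC.ne_zero_of_eq_or_eq hz
    obtain ⟨l₀, hl₀⟩ := hS.nonempty
    refine ⟨k, .inl ⟨z, hz, hmem _ (exists_eq_combination_of_vanish x y x' y' z
      (fun q g1 g2 g3 g4 => h l₀ hl₀ q (by simp [g1, g3]) (by simp [g2, g4]))), ?_, ?_⟩⟩
    · intro hmem
      obtain ⟨u, v, rfl⟩ := Submodule.mem_span_pair.mp hmem
      obtain ⟨g1, -, g3⟩ := hform (u * u) (2 * u * v) (v * v) fun l hl => by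
        obtain ⟨p, e1, e2, e3, e4⟩ := hpt l
        have := h l hl p (by rw [e1, e3]) (by rw [e2, e4])
        simp only [LinearMap.add_apply, LinearMap.smul_apply, smul_eq_mul, e1, e2] at this
        linear_combination (u * (l * (β + δ * l)) + v * -(α * l + γ)) * this
      rw [mul_self_eq_zero] at g1 g3
      exact hz0 (by simp [g1, g3])
    · intro hmem
      obtain ⟨u, v, rfl⟩ := Submodule.mem_span_pair.mp hmem
      obtain ⟨g1, -, g3⟩ := hform' (v * v) (2 * u * v) (u * u) fun l hl => by
        obtain ⟨p, e1, e2, e3, e4⟩ := hpt l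
        have := h l hl p (by rw [e1, e3]) (by rw [e2, e4])
        simp only [LinearMap.add_apply, LinearMap.smul_apply, smul_eq_mul, e3, e4] at this
        linear_combination (u * (β + δ * l) + v * (l * -(α * l + γ))) * this
      rw [mul_self_eq_zero] at g1 g3
      exact hz0 (by simp [g1, g3])

theorem exists_mem_sup_of_common_vector [Finite ι] (hC : IsProductConfiguration a b) {i j : ι}
    (hij : i ≠ j) (hi : LinearIndependent ℂ ![a i, b i]) (hj : LinearIndependent ℂ ![a j, b j])
    {w : Dual ℂ E} (hw0 : w ≠ 0) (hw : ∀ k, w ∈ Submodule.span ℂ {a k, b k})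
    (hinf : Submodule.span ℂ {a i, b i} ⊓ Submodule.span ℂ {a j, b j} ≤ Submodule.span ℂ {w}) :
    ∃ k z, (z = a k ∨ z = b k) ∧
      z ∈ Submodule.span ℂ {a i, b i} ⊔ Submodule.span ℂ {a j, b j} ∧
      z ∉ Submodule.span ℂ {a i, b i} ∧ z ∉ Submodule.span ℂ {a j, b j} := by
  obtain ⟨α, β, hαβ⟩ := Submodule.mem_span_pair.mp (hw i)
  obtain ⟨γ, δ, hγδ⟩ := Submodule.mem_span_pair.mp (hw j)
  have h1 : ¬ (α = 0 ∧ β = 0) := by rintro ⟨rfl, rfl⟩; exact hw0 (by simp [← hαβ])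
  have h2 : ¬ (γ = 0 ∧ δ = 0) := by rintro ⟨rfl, rfl⟩; exact hw0 (by simp [← hγδ])
  have hrel : ∀ c₁ c₂ c₃ c₄ : ℂ, c₁ • a i + c₂ • b i + c₃ • a j + c₄ • b j = 0 →
      ∃ t, c₁ = t * α ∧ c₂ = t * β ∧ c₃ = t * -γ ∧ c₄ = t * -δ := by
    intro c₁ c₂ c₃ c₄ h
    have h' : c₁ • a i + c₂ • b i = (-c₃) • a j + (-c₄) • b j := by
      rw [← sub_eq_zero, ← h]; module
    obtain ⟨t, ht⟩ := Submodule.mem_span_singleton.mp (hinf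
      ⟨Submodule.mem_span_pair.mpr ⟨c₁, c₂, rfl⟩, Submodule.mem_span_pair.mpr ⟨_, _, h'.symm⟩⟩)
    have g1 := LinearIndependent.pair_iff.mp hi (c₁ - t * α) (c₂ - t * β) (by
      rw [← sub_eq_zero, ← hαβ] at ht
      rw [← neg_eq_zero, ← ht]; module)
    have g2 := LinearIndependent.pair_iff.mp hj (-c₃ - t * γ) (-c₄ - t * δ) (by
      rw [h', ← sub_eq_zero, ← hγδ] at ht
      rw [← neg_eq_zero, ← ht]; module)
    exact ⟨t, by linear_combination g1.1, by linear_combination g1.2,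
      by linear_combination -g2.1, by linear_combination -g2.2⟩
  have key : ∃ k, (∃ z, (z = a k ∨ z = b k) ∧
        z ∈ Submodule.span ℂ {a i, b i} ⊔ Submodule.span ℂ {a j, b j} ∧
        z ∉ Submodule.span ℂ {a i, b i} ∧ z ∉ Submodule.span ℂ {a j, b j}) ∨
      (a k ∈ Submodule.span ℂ {a i, b i} ⊔ Submodule.span ℂ {a j, b j} ∧
        b k ∈ Submodule.span ℂ {a i, b i} ⊔ Submodule.span ℂ {a j, b j} ∧
        ¬ (a k ∈ Submodule.span ℂ {a i, b i} ∧ b k ∈ Submodule.span ℂ {a i, b i}) ∧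
        ¬ (a k ∈ Submodule.span ℂ {a j, b j} ∧ b k ∈ Submodule.span ℂ {a j, b j})) := by
    by_cases hdir : ¬ (α = 0 ∧ γ = 0) ∧ ¬ (β = 0 ∧ δ = 0)
    · exact hC.exists_mem_sup_of_conic hij (fun _ => rfl) (fun _ => rfl) hrel h1
        (by simpa using h2) (by simpa using hdir.1) (by simpa using hdir.2)
    · rw [Set.pair_comm (a j) (b j)]
      refine hC.exists_mem_sup_of_conic hij (fun _ => rfl) (fun p => mul_comm _ _)
        (fun c₁ c₂ c₃ c₄ h => ?_) h1 (γ := -δ) (δ := -γ) (by simpa [and_comm] using h2) ?_ ?_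
      · obtain ⟨t, g1, g2, g3, g4⟩ := hrel c₁ c₂ c₄ c₃ (by rw [← h]; module)
        exact ⟨t, g1, g2, g4, g3⟩
      · rw [neg_eq_zero]; tauto
      · rw [neg_eq_zero]; tauto
  obtain ⟨k, ⟨z, hz⟩ | ⟨ha, hb, hi', hj'⟩⟩ := key
  · exact ⟨k, z, hz⟩
  by_contra! hcon
  have hA := hcon k _ (.inl rfl) ha
  have hB := hcon k _ (.inr rfl) hb
  obtain ⟨r, s, hrs⟩ := Submodule.mem_span_pair.mp (hw k)
  have cross : ∀ V W : Submodule ℂ (Dual ℂ E), w ∈ V → w ∈ W → a k ∈ V → b k ∈ W →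
      ¬ (a k ∈ V ∧ b k ∈ V) → ¬ (a k ∈ W ∧ b k ∈ W) → False := by
    intro V W hV hW haV hbW hnV hnW
    have hs : s = 0 := by
      by_contra hs
      refine hnV ⟨haV, (Submodule.smul_mem_iff V hs).mp ?_⟩
      rw [← hrs] at hV
      exact (Submodule.add_mem_iff_right V (V.smul_mem r haV)).mp hV
    have hr : r = 0 := by
      by_contra hr
      refine hnW ⟨(Submodule.smul_mem_iff W hr).mp ?_, hbW⟩
      rw [← hrs] at hW
      exact (Submodule.add_mem_iff_left W (W.smul_mem s hbW)).mp hW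
    exact hw0 (by rw [← hrs, hr, hs]; simp)
  by_cases hAi : a k ∈ Submodule.span ℂ {a i, b i}
  · exact cross _ _ (hw i) (hw j) hAi (hB fun hBi => hi' ⟨hAi, hBi⟩) hi' hj'
  · have hAj := hA hAi
    have hBi : b k ∈ Submodule.span ℂ {a i, b i} := by
      by_contra hBi
      exact hj' ⟨hAj, hB hBi⟩
    exact cross _ _ (hw j) (hw i) hAj hBi hj' hi'

theorem exists_smul_eq_of_not_linearIndependent (hC : IsProductConfiguration a b) {k : ι}
    (hk : ¬ LinearIndependent ℂ ![a k, b k]) : ∃ c : ℂ, b k = c • a k := by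
  rw [LinearIndependent.pair_iff' (hC.left_ne_zero k)] at hk
  push Not at hk
  obtain ⟨c, hc⟩ := hk
  exact ⟨c, hc.symm⟩

theorem finrank_span_le_three_of_parallel [Finite ι] (hC : IsProductConfiguration a b)
    (hpar : ∀ k, ∃ c : ℂ, b k = c • a k) :
    finrank ℂ (Submodule.span ℂ (Set.range a ∪ Set.range b)) ≤ 3 := by
  choose c hc using hpar
  have hc0 : ∀ k, c k ≠ 0 := fun k h0 => hC.right_ne_zero k (by rw [hc, h0, zero_smul])
  have hspan : Submodule.span ℂ (Set.range a ∪ Set.range b) = Submodule.span ℂ (Set.range a) := by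
    refine le_antisymm (Submodule.span_le.mpr ?_) (Submodule.span_mono Set.subset_union_left)
    rintro _ (⟨k, rfl⟩ | ⟨k, rfl⟩)
    · exact Submodule.subset_span ⟨k, rfl⟩
    · rw [hc]
      exact Submodule.smul_mem _ _ (Submodule.subset_span ⟨k, rfl⟩)
  rw [hspan]
  refine kelly a fun i j hli => ?_
  have hind := LinearIndependent.pair_iff.mp hli
  have hij : i ≠ j := by
    rintro rfl
    simpa using hind 1 (-1) (by module)
  obtain ⟨μ, hμ⟩ := IsAlgClosed.exists_pow_nat_eq (c j / c i) (n := 2) two_pos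
  have hμ' : c i * μ ^ 2 = c j := by
    rw [hμ]
    field_simp [hc0 i]
  have hμ0 : μ ≠ 0 := by
    rintro rfl
    exact hc0 j (by rw [← hμ']; ring)
  obtain ⟨p, hpi, -, hpj, -⟩ := exists_apply_eq_four (a i) 0 (a j) 0 μ 0 1 0
    fun c₁ c₂ c₃ c₄ h => by
      obtain ⟨rfl, rfl⟩ := hind c₁ c₃ (by rw [← h]; simp)
      ring
  have hp : (a i - μ • a j) p = 0 := by simp [hpi, hpj]
  have hmul : ∀ k q, a k q * b k q = c k * a k q ^ 2 := fun k q => by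
    rw [hc]; simp only [LinearMap.smul_apply, smul_eq_mul]; ring
  have hcomb : ∀ k, (∀ q, a i q = 0 → a j q = 0 → a k q * b k q = 0) →
      ∃ s t : ℂ, a k = s • a i + t • a j := by
    intro k hk
    obtain ⟨c₁, _, c₃, _, h⟩ := exists_eq_combination_of_vanish (a i) 0 (a j) 0 (a k)
      (fun q h1 _ h3 _ => by simpa [hmul, hc0 k] using hk q h1 h3)
    exact ⟨c₁, c₃, by rw [h]; simp⟩
  have hvan : ∀ q, a i q = 0 → a j q = 0 → (a i - μ • a j) q = 0 := fun q h1 h2 => by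
    simp [h1, h2]
  have hthird := hC.exists_third (a i - μ • a j) 0 i j hij (fun q h1 _ => by
    have h1 : a i q = μ * a j q := by simpa [sub_eq_zero] using h1
    rw [hmul, hmul, h1, ← hμ']; ring)
  rcases hthird with h | ⟨k, hki, hkj, h | h⟩
  · have := h p hp rfl
    rw [hmul, hpi, hμ'] at this
    exact absurd this (hc0 j)
  · obtain ⟨s, t, hst⟩ := hcomb k fun q h1 h2 => by
      rw [h q (hvan q h1 h2) rfl, h1, zero_mul]
    have hkp := h p hp rfl
    rw [hmul, hmul, hst, hpi, hμ'] at hkp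
    simp only [LinearMap.add_apply, LinearMap.smul_apply, smul_eq_mul, hpi, hpj] at hkp
    refine ⟨k, s, t, ?_, ?_, hst⟩
    · rintro rfl
      refine hC.mul_ne_mul k j hkj fun q => ?_
      rw [hmul, hmul, hst]
      simp only [LinearMap.add_apply, LinearMap.smul_apply, smul_eq_mul]
      linear_combination (a j q) ^ 2 * hkp
    · rintro rfl
      refine hC.mul_ne_mul k i hki fun q => ?_
      rw [hmul, hmul, hst]
      simp only [LinearMap.add_apply, LinearMap.smul_apply, smul_eq_mul]
      have hks : c k * s ^ 2 = c i := by
        refine mul_right_cancel₀ (pow_ne_zero 2 hμ0) ?_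
        rw [hμ']
        linear_combination hkp
      linear_combination (a i q) ^ 2 * hks
  · obtain ⟨s, t, hst⟩ := hcomb k fun q h1 h2 => h q (hvan q h1 h2) rfl
    have hkp := h p hp rfl
    rw [hmul, hst] at hkp
    simp [hpi, hpj, hc0 k] at hkp
    refine ⟨k, s, t, ?_, ?_, hst⟩
    · rintro rfl
      exact hC.left_ne_zero k (by rw [hst]; simp at hkp; simp [hkp])
    · rintro rfl
      simp [hμ0] at hkp
      exact hC.left_ne_zero k (by rw [hst]; simp [hkp])

theorem _root_.span_pair_le_span_pair {F : Type*} [AddCommGroup F] [Module ℂ F] {u v x y : F}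
    (hx : x ∈ Submodule.span ℂ {u, v}) (hy : y ∈ Submodule.span ℂ {u, v})
    (hxy : LinearIndependent ℂ ![x, y]) : Submodule.span ℂ {u, v} ≤ Submodule.span ℂ {x, y} := by
  classical
  have hset : ({x, y} : Set F) = Set.range ![x, y] := by
    rw [Matrix.range_cons, Matrix.range_cons, Matrix.range_empty, Set.union_empty]
    rfl
  have h2 : finrank ℂ (Submodule.span ℂ {x, y}) = 2 := by
    rw [hset, finrank_span_eq_card hxy, Fintype.card_fin]
  have : FiniteDimensional ℂ (Submodule.span ℂ {u, v}) :=
    FiniteDimensional.span_of_finite ℂ (Set.toFinite _)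
  refine (Submodule.eq_of_le_of_finrank_le (Submodule.span_le.mpr ?_) ?_).ge
  · rintro _ (rfl | rfl) <;> assumption
  · rw [h2]
    have := finrank_span_finset_le_card (R := ℂ) ({u, v} : Finset F)
    rw [Set.finrank, Finset.coe_pair] at this
    exact this.trans Finset.card_le_two

theorem _root_.finrank_le_finrank_map_mkQ_add_one {F : Type*} [AddCommGroup F] [Module ℂ F]
    (X : Submodule ℂ F) [FiniteDimensional ℂ X] (w : F) :
    finrank ℂ X ≤ finrank ℂ (X.map (Submodule.span ℂ {w}).mkQ) + 1 := by
  have h := LinearMap.finrank_range_add_finrank_ker ((Submodule.span ℂ {w}).mkQ.domRestrict X)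
  rw [LinearMap.range_domRestrict] at h
  rw [← h]
  refine Nat.add_le_add_left ?_ _
  rw [← Submodule.finrank_map_subtype_eq]
  refine (Submodule.finrank_mono (t := Submodule.span ℂ {w}) ?_).trans
    ((finrank_span_le_card ({w} : Set F)).trans (by simp))
  rintro _ ⟨⟨z, hz⟩, hz', rfl⟩
  simpa using hz'

theorem finrank_span_le_four_of_common_vector [Finite ι] (hC : IsProductConfiguration a b)
    {w : Dual ℂ E} (hw0 : w ≠ 0) (hw : ∀ k, w ∈ Submodule.span ℂ {a k, b k}) :
    finrank ℂ (Submodule.span ℂ (Set.range a ∪ Set.range b)) ≤ 4 := by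
  have : FiniteDimensional ℂ (Submodule.span ℂ (Set.range a ∪ Set.range b)) :=
    FiniteDimensional.span_of_finite ℂ ((Set.finite_range a).union (Set.finite_range b))
  refine (finrank_le_finrank_map_mkQ_add_one _ w).trans (Nat.add_le_add_right ?_ 1)
  rw [Submodule.map_span, ← Set.Sum.elim_range, ← Set.range_comp]
  have hmem : ∀ s : ι ⊕ ι, ∃ k, (Sum.elim a b s = a k ∨ Sum.elim a b s = b k) := by
    rintro (k | k)
    exacts [⟨k, .inl rfl⟩, ⟨k, .inr rfl⟩]
  refine kelly _ fun s s' hli => ?_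
  obtain ⟨i, hi⟩ := hmem s
  obtain ⟨j, hj⟩ := hmem s'
  simp only [Function.comp_apply] at hli ⊢
  generalize Sum.elim a b s = x at *
  generalize Sum.elim a b s' = y at *
  have hmemV : ∀ (z : Dual ℂ E) (k : ι), (z = a k ∨ z = b k) → z ∈ Submodule.span ℂ {a k, b k} := by
    rintro z k (rfl | rfl) <;> exact Submodule.subset_span (by simp)
  have hxi := hmemV x i hi
  have hyj := hmemV y j hj
  have hind : ∀ r s : ℂ, r • x + s • y ∈ Submodule.span ℂ {w} → r = 0 ∧ s = 0 := by
    intro r s h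
    refine LinearIndependent.pair_iff.mp hli r s ?_
    rw [← map_smul, ← map_smul, ← map_add, Submodule.mkQ_apply, Submodule.Quotient.mk_eq_zero]
    exact h
  have hLI : ∀ (k : ι) (z : Dual ℂ E), z ∈ Submodule.span ℂ {a k, b k} →
      z ∉ Submodule.span ℂ {w} → LinearIndependent ℂ ![a k, b k] := by
    intro k z hz hzw
    by_contra hk
    obtain ⟨c, hc⟩ := hC.exists_smul_eq_of_not_linearIndependent hk
    obtain ⟨r, s, hrs⟩ := Submodule.mem_span_pair.mp (hw k)
    obtain ⟨r', s', hrs'⟩ := Submodule.mem_span_pair.mp hz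
    have h0 : r + s * c ≠ 0 := by
      intro h0
      refine hw0 ?_
      rw [← hrs, hc, smul_smul, ← add_smul, h0, zero_smul]
    refine hzw (Submodule.mem_span_singleton.mpr ⟨(r' + s' * c) * (r + s * c)⁻¹, ?_⟩)
    rw [← hrs, ← hrs', hc, smul_smul, smul_smul, ← add_smul, ← add_smul, smul_smul, mul_assoc,
      inv_mul_cancel₀ h0, mul_one]
  have hxw : x ∉ Submodule.span ℂ {w} := fun h => by simpa using hind 1 0 (by simpa using h)
  have hyw : y ∉ Submodule.span ℂ {w} := fun h => by simpa using hind 0 1 (by simpa using h)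
  have hpair : ∀ z ∉ Submodule.span ℂ {w}, LinearIndependent ℂ ![w, z] := by
    intro z hz
    rw [LinearIndependent.pair_iff' hw0]
    rintro r rfl
    exact hz (Submodule.smul_mem _ _ (Submodule.mem_span_singleton_self w))
  have hVi := span_pair_le_span_pair (hw i) hxi (hpair x hxw)
  have hVj := span_pair_le_span_pair (hw j) hyj (hpair y hyw)
  have hwm : ∀ r : ℂ, r • w ∈ Submodule.span ℂ {w} := fun r =>
    Submodule.smul_mem _ _ (Submodule.mem_span_singleton_self w)
  have hij : i ≠ j := by
    rintro rfl
    obtain ⟨r, s, hrs⟩ := Submodule.mem_span_pair.mp (hVi hyj)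
    have := hind (-s) 1 (by rw [← hrs]; convert hwm r using 1; module)
    simp at this
  have hinf : Submodule.span ℂ {a i, b i} ⊓ Submodule.span ℂ {a j, b j} ≤
      Submodule.span ℂ {w} := by
    rintro u ⟨hu, hu'⟩
    obtain ⟨r, s, hrs⟩ := Submodule.mem_span_pair.mp (hVi hu)
    obtain ⟨r', s', hrs'⟩ := Submodule.mem_span_pair.mp (hVj hu')
    have := hind s (-s') (by
      convert hwm (r' - r) using 1
      rw [← sub_eq_zero] at hrs'
      rw [← sub_eq_zero, ← sub_eq_zero.mpr (hrs.trans (sub_eq_zero.mp hrs').symm)]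
      module)
    rw [← hrs, this.1, zero_smul, add_zero]
    exact hwm r
  obtain ⟨k, z, hz, hzsup, hzi, hzj⟩ := hC.exists_mem_sup_of_common_vector hij (hLI i x hxi hxw)
    (hLI j y hyj hyw) hw0 hw hinf
  obtain ⟨z₁, hz₁, z₂, hz₂, hzz⟩ := Submodule.mem_sup.mp hzsup
  obtain ⟨r, s, rfl⟩ := Submodule.mem_span_pair.mp (hVi hz₁)
  obtain ⟨r', s', rfl⟩ := Submodule.mem_span_pair.mp (hVj hz₂)
  have hzmk : (Submodule.span ℂ {w}).mkQ z =
      s • (Submodule.span ℂ {w}).mkQ x + s' • (Submodule.span ℂ {w}).mkQ y := by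
    have hwz : (Submodule.span ℂ {w}).mkQ w = 0 := by
      simp [Submodule.mem_span_singleton_self]
    rw [← hzz]
    simp [map_add, map_smul, -Submodule.mkQ_apply, hwz]
  have hs : s ≠ 0 := by
    rintro rfl
    refine hzj ?_
    rw [← hzz, zero_smul, add_zero]
    exact Submodule.add_mem _ (Submodule.smul_mem _ _ (hw j)) hz₂
  have hs' : s' ≠ 0 := by
    rintro rfl
    refine hzi ?_
    rw [← hzz, zero_smul, add_zero]
    exact Submodule.add_mem _ hz₁ (Submodule.smul_mem _ _ (hw i))
  rcases hz with rfl | rfl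
  · exact ⟨.inl k, s, s', hs, hs', hzmk⟩
  · exact ⟨.inr k, s, s', hs, hs', hzmk⟩

theorem exists_ne_zero_mem_inf [Finite ι] (hC : IsProductConfiguration a b) {i j : ι}
    (hi : LinearIndependent ℂ ![a i, b i]) (hj : LinearIndependent ℂ ![a j, b j]) :
    ∃ u ≠ 0, u ∈ Submodule.span ℂ {a i, b i} ∧ u ∈ Submodule.span ℂ {a j, b j} := by
  by_cases hij : i = j
  · subst hij
    exact ⟨a i, hC.left_ne_zero i, Submodule.subset_span (by simp), Submodule.subset_span (by simp)⟩
  obtain ⟨c₁, c₂, c₃, c₄, h, hne⟩ := hC.exists_relation hij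
  have h' : (-c₃) • a j + (-c₄) • b j = c₁ • a i + c₂ • b i := by
    rw [← sub_eq_zero, ← neg_eq_zero, ← h]; module
  refine ⟨c₁ • a i + c₂ • b i, fun h0 => hne ?_, Submodule.mem_span_pair.mpr ⟨_, _, rfl⟩,
    Submodule.mem_span_pair.mpr ⟨_, _, h'⟩⟩
  have g1 := LinearIndependent.pair_iff.mp hi c₁ c₂ h0
  have g2 := LinearIndependent.pair_iff.mp hj (-c₃) (-c₄) (h'.trans h0)
  simpa using And.intro g1.1 (And.intro g1.2 g2)

/-- The functionals of a finite product configuration span a space of dimension at most four. -/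
theorem finrank_span_le_four [Finite ι] (hC : IsProductConfiguration a b) :
    finrank ℂ (Submodule.span ℂ (Set.range a ∪ Set.range b)) ≤ 4 := by
  classical
  let V : ι → Submodule ℂ (Dual ℂ E) := fun k => Submodule.span ℂ {a k, b k}
  have hV : ∀ k l, ¬ LinearIndependent ℂ ![a k, b k] → LinearIndependent ℂ ![a l, b l] →
      V k ≤ V l := by
    intro k l hk hl
    have hkl : k ≠ l := by rintro rfl; exact hk hl
    obtain ⟨c, hc⟩ := hC.exists_smul_eq_of_not_linearIndependent hk
    have hmem := hC.mem_span_pair_of_parallel hkl hc hl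
    refine Submodule.span_le.mpr ?_
    rintro _ (rfl | rfl)
    · exact hmem
    · rw [hc]; exact Submodule.smul_mem _ _ hmem
  have hbound : ∀ i j, (∀ k, V k ≤ V i ⊔ V j) →
      finrank ℂ (Submodule.span ℂ (Set.range a ∪ Set.range b)) ≤ 4 := by
    intro i j h
    have hfin : ∀ k, FiniteDimensional ℂ (V k) := fun k =>
      FiniteDimensional.span_of_finite ℂ (Set.toFinite _)
    have hcard : ∀ k, finrank ℂ (V k) ≤ 2 := fun k => by
      have := finrank_span_finset_le_card (R := ℂ) ({a k, b k} : Finset (Dual ℂ E))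
      rw [Set.finrank, Finset.coe_pair] at this
      exact this.trans Finset.card_le_two
    have hle : Submodule.span ℂ (Set.range a ∪ Set.range b) ≤ V i ⊔ V j := by
      refine Submodule.span_le.mpr ?_
      rintro _ (⟨k, rfl⟩ | ⟨k, rfl⟩)
      · exact h k (Submodule.subset_span (by simp))
      · exact h k (Submodule.subset_span (by simp))
    exact (Submodule.finrank_mono hle).trans ((Submodule.finrank_add_le_finrank_add_finrank _ _).trans
      (add_le_add (hcard i) (hcard j)))
  by_cases hpar : ∀ k, ¬ LinearIndependent ℂ ![a k, b k]
  · exact (hC.finrank_span_le_three_of_parallel fun k =>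
      hC.exists_smul_eq_of_not_linearIndependent (hpar k)).trans (by norm_num)
  push Not at hpar
  obtain ⟨i, hi⟩ := hpar
  by_cases hall : ∀ k, V k ≤ V i
  · exact hbound i i fun k => (hall k).trans le_sup_left
  push Not at hall
  obtain ⟨j, hji⟩ := hall
  have hj : LinearIndependent ℂ ![a j, b j] := by
    by_contra hj
    exact hji (hV j i hj hi)
  obtain ⟨w, hw0, hwi, hwj⟩ := hC.exists_ne_zero_mem_inf hi hj
  by_cases hw : ∀ k, w ∈ Submodule.span ℂ {a k, b k}
  · exact hC.finrank_span_le_four_of_common_vector hw0 hw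
  push Not at hw
  obtain ⟨k, hwk⟩ := hw
  have hpair : ∀ u v : Dual ℂ E, u ≠ 0 → v ∉ Submodule.span ℂ {u} →
      LinearIndependent ℂ ![u, v] := by
    intro u v hu hv
    rw [LinearIndependent.pair_iff' hu]
    rintro r rfl
    exact hv (Submodule.smul_mem _ _ (Submodule.mem_span_singleton_self u))
  have hle : ∀ l (u v : Dual ℂ E) (X : Submodule ℂ (Dual ℂ E)), u ∈ V l → v ∈ V l →
      u ≠ 0 → v ∉ Submodule.span ℂ {u} → u ∈ X → v ∈ X → V l ≤ X := by
    intro l u v X hu hv hu0 huv huX hvX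
    refine (span_pair_le_span_pair hu hv (hpair u v hu0 huv)).trans (Submodule.span_le.mpr ?_)
    rintro _ (rfl | rfl) <;> assumption
  have hinf : ∀ u, u ∈ V i → u ∈ V j → u ∈ Submodule.span ℂ {w} := by
    intro u hui huj
    by_contra hu
    exact hji (hle j w u (V i) hwj huj hw0 hu hwi hui)
  have hout : ∀ l, LinearIndependent ℂ ![a l, b l] → w ∉ V l → V l ≤ V i ⊔ V j := by
    intro l hl hwl
    obtain ⟨u, hu0, hul, hui⟩ := hC.exists_ne_zero_mem_inf hl hi
    obtain ⟨v, hv0, hvl, hvj⟩ := hC.exists_ne_zero_mem_inf hl hj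
    refine hle l u v _ hul hvl hu0 (fun hvu => hwl ?_) (Submodule.mem_sup_left hui)
      (Submodule.mem_sup_right hvj)
    have hvi : v ∈ V i := (Submodule.span_singleton_le_iff_mem u (V i)).mpr hui hvu
    obtain ⟨t, rfl⟩ := Submodule.mem_span_singleton.mp (hinf v hvi hvj)
    have ht : t ≠ 0 := by rintro rfl; simp at hv0
    exact (Submodule.smul_mem_iff _ ht).mp hvl
  have hk : LinearIndependent ℂ ![a k, b k] := by
    by_contra hk
    refine hwk ?_
    have hmem : a k ∈ Submodule.span ℂ {a k, b k} := Submodule.subset_span (by simp)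
    obtain ⟨t, ht⟩ := Submodule.mem_span_singleton.mp
      (hinf (a k) (hV k i hk hi hmem) (hV k j hk hj hmem))
    have ht0 : t ≠ 0 := by
      rintro rfl
      exact hC.left_ne_zero k (by rw [← ht, zero_smul])
    exact (Submodule.smul_mem_iff _ ht0).mp (ht ▸ hmem)
  refine hbound i j fun l => ?_
  by_cases hl : LinearIndependent ℂ ![a l, b l]
  swap
  · exact (hV l i hl hi).trans le_sup_left
  by_cases hwl : w ∈ V l
  swap
  · exact hout l hl hwl
  obtain ⟨u, hu0, hul, huk⟩ := hC.exists_ne_zero_mem_inf hl hk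
  refine hle l u w _ hul hwl hu0 (fun hwu => hwk ?_) (hout k hk hwk huk)
    (Submodule.mem_sup_left hwi)
  exact (Submodule.span_singleton_le_iff_mem u _).mpr huk hwu

end IsProductConfiguration

namespace MvPolynomial

open Module

variable {n : ℕ}

/-- The linear functional `p ↦ ∑ i, f(e i) * p i` attached to a polynomial `f`; it is evaluation
of `f` when `f` is a linear form. -/
noncomputable def toDual : MvPolynomial (Fin n) ℂ →ₗ[ℂ] Dual ℂ (Fin n → ℂ) where
  toFun f := ∑ i, eval (Pi.single i 1) f • LinearMap.proj i
  map_add' f g := by simp [add_smul, Finset.sum_add_distrib]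
  map_smul' c f := by simp [smul_eval, mul_smul, Finset.smul_sum]

theorem toDual_apply {f : MvPolynomial (Fin n) ℂ} (hf : f.IsHomogeneous 1) (p : Fin n → ℂ) :
    toDual f p = eval p f := by
  have hspan : f ∈ Submodule.span ℂ (Set.range X) := by
    rw [← homogeneousSubmodule_one_eq_span_X]
    exact hf
  clear hf
  induction hspan using Submodule.span_induction with
  | mem x h =>
    obtain ⟨i, rfl⟩ := h
    simp [toDual, Pi.single_apply]
  | zero => simp
  | add x y _ _ hx hy => simp [hx, hy]
  | smul c x _ hx => simp [hx, smul_eval]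

/-- The linear form attached to a linear functional. -/
noncomputable def ofDual (g : Dual ℂ (Fin n → ℂ)) : MvPolynomial (Fin n) ℂ :=
  ∑ i, C (g (Pi.single i 1)) * X i

theorem isHomogeneous_ofDual (g : Dual ℂ (Fin n → ℂ)) : (ofDual g).IsHomogeneous 1 :=
  IsHomogeneous.sum _ _ _ fun _ _ => isHomogeneous_C_mul_X _ _

theorem eval_ofDual (g : Dual ℂ (Fin n → ℂ)) (p : Fin n → ℂ) : eval p (ofDual g) = g p := by
  conv_rhs => rw [pi_eq_sum_univ' p]
  simp [ofDual, map_sum, mul_comm]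

theorem exists_projection (c d : Dual ℂ (Fin n → ℂ)) :
    ∃ (g h : Dual ℂ (Fin n → ℂ)) (v w : Fin n → ℂ),
      (∀ p, c (p - g p • v - h p • w) = 0 ∧ d (p - g p • v - h p • w) = 0) ∧
      ∀ p, c p = 0 → d p = 0 → g p = 0 ∧ h p = 0 := by
  obtain ⟨v, hv⟩ : ∃ v, ∀ p, c (p - c p • v) = 0 := by
    by_cases hc : ∃ q, c q ≠ 0
    · obtain ⟨q, hq⟩ := hc
      exact ⟨(c q)⁻¹ • q, fun p => by simp [hq]⟩
    · push Not at hc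
      exact ⟨0, fun p => hc _⟩
  obtain ⟨w, hcw, hw⟩ : ∃ w, c w = 0 ∧ ∀ q, c q = 0 → d (q - d q • w) = 0 := by
    by_cases hd : ∃ q, c q = 0 ∧ d q ≠ 0
    · obtain ⟨q, hcq, hdq⟩ := hd
      exact ⟨(d q)⁻¹ • q, by simp [hcq], fun p _ => by simp [hdq]⟩
    · push Not at hd
      exact ⟨0, by simp, fun q hq => by simpa using hd q hq⟩
  refine ⟨c, d - d v • c, v, w, fun p => ⟨?_, ?_⟩, fun p h1 h2 => ⟨h1, by simp [h1, h2]⟩⟩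
  · simpa [hcw] using hv p
  · simpa [mul_comm] using hw _ (hv p)

/-- Restriction of polynomials to a subspace cut out by two linear functionals, realised as
substitution of a linear projection. -/
theorem exists_restriction (c d : Dual ℂ (Fin n → ℂ)) :
    ∃ φ : MvPolynomial (Fin n) ℂ →ₐ[ℂ] MvPolynomial (Fin n) ℂ,
      (∀ f m, f.IsHomogeneous m → (φ f).IsHomogeneous m) ∧
      (∀ f g, φ f = φ g ↔ ∀ p, c p = 0 → d p = 0 → eval p f = eval p g) ∧
      ∀ G, G.IsHomogeneous 2 → ∃ L₁ L₂ L₃ L₄ : MvPolynomial (Fin n) ℂ,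
        L₁.IsHomogeneous 1 ∧ L₂.IsHomogeneous 1 ∧ L₃.IsHomogeneous 1 ∧ L₄.IsHomogeneous 1 ∧
        G = φ G + (L₁ * L₂ + L₃ * L₄) := by
  obtain ⟨g, h, v, w, hT, hfix⟩ := exists_projection c d
  let Y : Fin n → MvPolynomial (Fin n) ℂ := fun i =>
    X i - C (v i) * ofDual g - C (w i) * ofDual h
  have hY : ∀ i, (Y i).IsHomogeneous 1 := fun i =>
    ((isHomogeneous_X _ i).sub ((isHomogeneous_ofDual g).C_mul _)).sub
      ((isHomogeneous_ofDual h).C_mul _)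
  have heval : ∀ f p, eval p (aeval Y f) = eval (p - g p • v - h p • w) f := by
    intro f p
    have : (p - g p • v - h p • w) = fun i => eval p (Y i) := by
      funext i
      simp [Y, eval_ofDual, mul_comm]
    rw [this]
    induction f using MvPolynomial.induction_on with
    | C r => simp
    | add f₁ f₂ h₁ h₂ => rw [map_add, map_add, map_add, h₁, h₂]
    | mul_X f i hf => rw [map_mul, map_mul, map_mul, hf, aeval_X, eval_X]
  have hhom : ∀ (f : MvPolynomial (Fin n) ℂ) m, f.IsHomogeneous m →
      (aeval Y f).IsHomogeneous m := fun f m hf => by simpa using hf.aeval Y hY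
  refine ⟨aeval Y, hhom, fun f f' => ⟨fun he p h1 h2 => ?_, fun he => ?_⟩, fun G hG => ?_⟩
  · have := congrArg (eval p) he
    rw [heval, heval] at this
    obtain ⟨h3, h4⟩ := hfix p h1 h2
    simpa [h3, h4] using this
  · refine MvPolynomial.funext fun p => ?_
    rw [heval, heval]
    exact he _ (hT p).1 (hT p).2
  · have hlin : ∀ L : MvPolynomial (Fin n) ℂ, L.IsHomogeneous 1 →
        L - aeval Y L = C (eval v L) * ofDual g + C (eval w L) * ofDual h := by
      intro L hL
      refine MvPolynomial.funext fun p => ?_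
      simp only [map_sub, map_add, map_mul, eval_C, heval, eval_ofDual, ← toDual_apply hL,
        map_smul, smul_eq_mul]
      ring
    have hd : ∀ i, (pderiv i G).IsHomogeneous 1 := fun i => hG.pderiv
    refine ⟨ofDual g, C (1 / 2) * ∑ i, (C (v i) * pderiv i G + C (eval v (pderiv i G)) * Y i),
      ofDual h, C (1 / 2) * ∑ i, (C (w i) * pderiv i G + C (eval w (pderiv i G)) * Y i),
      isHomogeneous_ofDual g, ?_, isHomogeneous_ofDual h, ?_, ?_⟩
    · exact IsHomogeneous.C_mul (IsHomogeneous.sum _ _ _ fun i _ =>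
        ((hd i).C_mul _).add ((hY i).C_mul _)) _
    · exact IsHomogeneous.C_mul (IsHomogeneous.sum _ _ _ fun i _ =>
        ((hd i).C_mul _).add ((hY i).C_mul _)) _
    · have hE : G = C (1 / 2) * ∑ i, X i * pderiv i G := by
        rw [hG.sum_X_mul_pderiv, nsmul_eq_mul, ← mul_assoc, Nat.cast_ofNat,
          ← map_ofNat (C : ℂ →+* MvPolynomial (Fin n) ℂ) 2, ← C_mul]
        norm_num
      have hE' : aeval Y G = C (1 / 2) * ∑ i, Y i * aeval Y (pderiv i G) := by
        conv_lhs => rw [hE]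
        simp [algebraMap_eq]
      rw [hE']
      conv_lhs => rw [hE]
      rw [mul_left_comm, mul_left_comm (ofDual h), ← mul_add, ← mul_add]
      congr 1
      rw [Finset.mul_sum, Finset.mul_sum, ← Finset.sum_add_distrib, ← Finset.sum_add_distrib]
      refine Finset.sum_congr rfl fun i _ => ?_
      have h1 := hlin _ (hd i)
      have h2 : X i = Y i + C (v i) * ofDual g + C (w i) * ofDual h := by simp only [Y]; ring
      rw [h2]
      linear_combination Y i * h1

theorem exists_eq_mul_of_not_irreducible {G : MvPolynomial (Fin n) ℂ} (hG : G.IsHomogeneous 2)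
    (hirr : ¬ Irreducible G) : ∃ L M : MvPolynomial (Fin n) ℂ,
      L.IsHomogeneous 1 ∧ M.IsHomogeneous 1 ∧ G = L * M := by
  by_cases hG0 : G = 0
  · exact ⟨0, 0, isHomogeneous_zero _ _ _, isHomogeneous_zero _ _ _, by simp [hG0]⟩
  have hdeg := hG.totalDegree hG0
  have hunit : ∀ f : MvPolynomial (Fin n) ℂ, f ≠ 0 → f.totalDegree = 0 → IsUnit f := by
    intro f hf hf0
    rw [totalDegree_eq_zero_iff_eq_C] at hf0
    rw [hf0] at hf ⊢
    exact (IsUnit.mk0 _ (fun h => hf (by rw [h, C_0]))).map C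
  have hnu : ¬ IsUnit G := fun h => by
    rw [isUnit_iff_totalDegree_of_isReduced] at h
    omega
  rw [irreducible_iff] at hirr
  push Not at hirr
  obtain ⟨f, g, hfg, hf, hg⟩ := hirr hnu
  have hf0 : f ≠ 0 := by rintro rfl; simp at hfg; exact hG0 hfg
  have hg0 : g ≠ 0 := by rintro rfl; simp at hfg; exact hG0 hfg
  rw [hfg, totalDegree_mul_of_isDomain hf0 hg0] at hdeg
  have hf1 : f.totalDegree ≠ 0 := fun h => hf (hunit f hf0 h)
  have hg1 : g.totalDegree ≠ 0 := fun h => hg (hunit g hg0 h)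
  have hsplit : ∀ f : MvPolynomial (Fin n) ℂ, f.totalDegree = 1 →
      f = homogeneousComponent 0 f + homogeneousComponent 1 f := by
    intro f hf
    conv_lhs => rw [← sum_homogeneousComponent f, hf]
    simp [Finset.sum_range_succ]
  refine ⟨homogeneousComponent 1 f, homogeneousComponent 1 g,
    homogeneousComponent_isHomogeneous _ _, homogeneousComponent_isHomogeneous _ _, ?_⟩
  have hc : ∀ (p : MvPolynomial (Fin n) ℂ) {k : ℕ}, p.IsHomogeneous k →
      homogeneousComponent 2 p = if k = 2 then p else 0 := by
    intro p k hp
    simp [homogeneousComponent_of_mem hp, eq_comm]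
  have hm := fun i j => (homogeneousComponent_isHomogeneous i f).mul
    (homogeneousComponent_isHomogeneous j g)
  have hG2 := hc G hG
  rw [if_pos rfl] at hG2
  rw [← hG2]
  conv_lhs => rw [hfg, hsplit f (by omega), hsplit g (by omega)]
  rw [add_mul, mul_add, mul_add, map_add, map_add, map_add, hc _ (hm 0 0), hc _ (hm 0 1),
    hc _ (hm 1 0), hc _ (hm 1 1)]
  simp

theorem ne_sum_mul_of_rankS {Q : MvPolynomial (Fin n) ℂ} (hrk : 100 ≤ rankS Q)
    {L M : Fin 4 → MvPolynomial (Fin n) ℂ}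
    (hL : ∀ i, (L i).IsHomogeneous 1) (hM : ∀ i, (M i).IsHomogeneous 1) :
    Q ≠ L 0 * M 0 + L 1 * M 1 + L 2 * M 2 + L 3 * M 3 := by
  rintro rfl
  rw [← Fin.sum_univ_four (fun i => L i * M i)] at hrk
  have : rankS (∑ i, L i * M i) ≤ 4 := Nat.sInf_le ⟨L, M, hL, hM, rfl⟩
  omega

/-- A quadratic of large rank does not become a sum of two products on a subspace of
codimension at most two. -/
theorem not_eqOn_add_mul {Q : MvPolynomial (Fin n) ℂ} (hQ : Q.IsHomogeneous 2)
    (hrk : 100 ≤ rankS Q) (c d : Dual ℂ (Fin n → ℂ)) {L₁ L₂ L₃ L₄ : MvPolynomial (Fin n) ℂ}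
    (h₁ : L₁.IsHomogeneous 1) (h₂ : L₂.IsHomogeneous 1) (h₃ : L₃.IsHomogeneous 1)
    (h₄ : L₄.IsHomogeneous 1) :
    ¬ ∀ p, c p = 0 → d p = 0 → eval p Q = eval p (L₁ * L₂ + L₃ * L₄) := by
  intro h
  obtain ⟨φ, -, hφ, hdec⟩ := exists_restriction c d
  obtain ⟨M₁, M₂, M₃, M₄, k₁, k₂, k₃, k₄, hG⟩ := hdec (Q - (L₁ * L₂ + L₃ * L₄))
    (hQ.sub ((h₁.mul h₂).add (h₃.mul h₄)))
  rw [map_sub, sub_eq_zero.2 ((hφ _ _).2 h)] at hG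
  refine ne_sum_mul_of_rankS hrk (L := ![L₁, L₃, M₁, M₃]) (M := ![L₂, L₄, M₂, M₄])
    (by simp [Fin.forall_fin_succ, *]) (by simp [Fin.forall_fin_succ, *]) ?_
  simp only [Matrix.cons_val]
  linear_combination hG

/-- If two members of a family satisfying the radical condition become proportional on a subspace
of codimension at most two and one of them has large rank, then a third member becomes
proportional to them there. -/
theorem exists_eqOn_smul {κ : Type*} [Fintype κ] [DecidableEq κ] {F : κ → MvPolynomial (Fin n) ℂ}
    (hF : ∀ k, (F k).IsHomogeneous 2) {Q : MvPolynomial (Fin n) ℂ} (hrk : 100 ≤ rankS Q)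
    {x y : κ} {a b : MvPolynomial (Fin n) ℂ} (ha : a.IsHomogeneous 1) (hb : b.IsHomogeneous 1)
    (hx : F x = Q + a * b)
    (hrad : (∏ k ∈ (Finset.univ.erase x).erase y, F k) ∈ (Ideal.span {F x, F y}).radical)
    (c d : Dual ℂ (Fin n → ℂ)) (s : ℂ)
    (hs : ∀ p, c p = 0 → d p = 0 → eval p (F y) = s * eval p (F x)) :
    ∃ k, k ≠ x ∧ k ≠ y ∧ ∃ α : ℂ, ∀ p, c p = 0 → d p = 0 → eval p (F k) = α * eval p (F x) := by
  obtain ⟨φ, hhom, hφ, hdec⟩ := exists_restriction c d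
  have hirr : Irreducible (φ (F x)) := by
    by_contra hirr
    obtain ⟨L, M, hL, hM, hLM⟩ := exists_eq_mul_of_not_irreducible (hhom _ _ (hF x)) hirr
    obtain ⟨M₁, M₂, M₃, M₄, k₁, k₂, k₃, k₄, hG⟩ := hdec _ (hF x)
    refine ne_sum_mul_of_rankS hrk (L := ![L, -a, M₁, M₃]) (M := ![M, b, M₂, M₄])
      (by simp [Fin.forall_fin_succ, *, ha.neg]) (by simp [Fin.forall_fin_succ, *]) ?_
    simp only [Matrix.cons_val]
    linear_combination hG + hLM - hx
  have hy : φ (F y) = C s * φ (F x) := by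
    have : φ (F y) = φ (C s * F x) := (hφ _ _).2 fun p h1 h2 => by simp [hs p h1 h2]
    rw [this, map_mul, ← algebraMap_eq, AlgHom.commutes]
  obtain ⟨N, hN⟩ := hrad
  obtain ⟨u, v, huv⟩ := Ideal.mem_span_pair.1 hN
  have hdvd : φ (F x) ∣ (∏ k ∈ (Finset.univ.erase x).erase y, φ (F k)) ^ N := by
    rw [← map_prod, ← map_pow, ← huv, map_add, map_mul, map_mul, hy]
    exact ⟨φ u + φ v * C s, by ring⟩
  obtain ⟨k, hk, hdk⟩ := (hirr.prime.dvd_finsetProd_iff _).1 (hirr.prime.dvd_of_dvd_pow hdvd)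
  simp only [Finset.mem_erase, Finset.mem_univ, and_true] at hk
  refine ⟨k, hk.2, hk.1, ?_⟩
  obtain ⟨q, hq⟩ := hdk
  obtain ⟨α, rfl⟩ : ∃ α, q = C α := by
    by_cases hq0 : q = 0
    · exact ⟨0, by simp [hq0]⟩
    have hk0 : φ (F k) ≠ 0 := by rw [hq]; exact mul_ne_zero hirr.ne_zero hq0
    have hdeg := (hhom _ _ (hF k)).totalDegree hk0
    rw [hq, totalDegree_mul_of_isDomain hirr.ne_zero hq0,
      (hhom _ _ (hF x)).totalDegree hirr.ne_zero] at hdeg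
    exact ⟨_, (totalDegree_eq_zero_iff_eq_C).1 (by omega)⟩
  refine ⟨α, fun p h1 h2 => ?_⟩
  have : φ (F k) = φ (C α * F x) := by
    rw [hq, map_mul, ← algebraMap_eq, AlgHom.commutes, mul_comm]
  simpa using (hφ _ _).1 this p h1 h2

theorem mul_eqOn_of_eqOn_smul {Q : MvPolynomial (Fin n) ℂ} (hQ : Q.IsHomogeneous 2)
    (hrk : 100 ≤ rankS Q) (c d : Dual ℂ (Fin n → ℂ)) {a b a' b' : MvPolynomial (Fin n) ℂ}
    (ha : a.IsHomogeneous 1) (hb : b.IsHomogeneous 1) (ha' : a'.IsHomogeneous 1)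
    (hb' : b'.IsHomogeneous 1) {α : ℂ}
    (h : ∀ p, c p = 0 → d p = 0 → eval p (Q + a' * b') = α * eval p (Q + a * b)) :
    ∀ p, c p = 0 → d p = 0 → eval p a' * eval p b' = eval p a * eval p b := by
  obtain rfl : α = 1 := by
    by_contra hα
    have hα' : 1 - α ≠ 0 := sub_ne_zero.2 (Ne.symm hα)
    refine not_eqOn_add_mul hQ hrk c d (ha.C_mul (α / (1 - α))) hb
      (ha'.C_mul (-1 / (1 - α))) hb' fun p h1 h2 => ?_
    have := h p h1 h2
    simp only [map_add, map_mul, eval_C] at this ⊢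
    field_simp
    linear_combination this
  intro p h1 h2
  have := h p h1 h2
  simp only [map_add, map_mul] at this
  linear_combination this

theorem eqOn_zero_of_sq_eqOn_smul {Q : MvPolynomial (Fin n) ℂ} (hQ : Q.IsHomogeneous 2)
    (hrk : 100 ≤ rankS Q) (c d : Dual ℂ (Fin n → ℂ)) {a b l : MvPolynomial (Fin n) ℂ}
    (ha : a.IsHomogeneous 1) (hb : b.IsHomogeneous 1) (hl : l.IsHomogeneous 1) {α : ℂ}
    (h : ∀ p, c p = 0 → d p = 0 → eval p (l ^ 2) = α * eval p (Q + a * b)) :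
    ∀ p, c p = 0 → d p = 0 → eval p l = 0 := by
  obtain rfl : α = 0 := by
    by_contra hα
    refine not_eqOn_add_mul hQ hrk c d (hl.C_mul α⁻¹) hl ha.neg hb fun p h1 h2 => ?_
    have := h p h1 h2
    simp only [map_add, map_mul, eval_C, map_pow, map_neg] at this ⊢
    field_simp
    linear_combination -this
  intro p h1 h2
  simpa using h p h1 h2

theorem exists_eq_smul_of_eqOn_zero {f g : MvPolynomial (Fin n) ℂ} (hf : f.IsHomogeneous 1)
    (hg : g.IsHomogeneous 1) (h : ∀ p, eval p f = 0 → eval p g = 0) : ∃ e : ℂ, g = e • f := by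
  obtain ⟨e₁, e₂, e₃, e₄, he⟩ := exists_eq_combination_of_vanish (toDual f) (toDual f) (toDual f)
    (toDual f) (toDual g) fun p hp _ _ _ => by
      rw [toDual_apply hf] at hp
      rw [toDual_apply hg, h p hp]
  refine ⟨e₁ + e₂ + e₃ + e₄, MvPolynomial.funext fun p => ?_⟩
  rw [← toDual_apply hg, he]
  simp only [LinearMap.add_apply, LinearMap.smul_apply, toDual_apply hf, smul_eval, smul_eq_mul]
  ring

section Configuration

variable {m r : ℕ} {Q : MvPolynomial (Fin n) ℂ} {P a b : Fin m → MvPolynomial (Fin n) ℂ}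
  {l : Fin r → MvPolynomial (Fin n) ℂ}

theorem exists_third_member (hset : IsQoSet m 0 r Q P Fin.elim0 l) (hrk : 100 ≤ rankS Q)
    (ha : ∀ j, (a j).IsHomogeneous 1) (hb : ∀ j, (b j).IsHomogeneous 1)
    (hP : ∀ j, P j = Q + a j * b j) {x y : Unit ⊕ Fin m ⊕ Fin 0 ⊕ Fin r} (hxy : x ≠ y)
    {a' b' : MvPolynomial (Fin n) ℂ} (ha' : a'.IsHomogeneous 1) (hb' : b'.IsHomogeneous 1)
    (hx : QoFam Q P Fin.elim0 l x = Q + a' * b') (c d : Dual ℂ (Fin n → ℂ)) (s : ℂ)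
    (hs : ∀ p, c p = 0 → d p = 0 → eval p (QoFam Q P Fin.elim0 l y) = s * eval p (Q + a' * b')) :
    (x ≠ .inl () ∧ ∀ p, c p = 0 → d p = 0 → eval p a' * eval p b' = 0) ∨
    (∃ k, .inr (.inl k) ≠ x ∧ .inr (.inl k) ≠ y ∧
      ∀ p, c p = 0 → d p = 0 → eval p (a k) * eval p (b k) = eval p a' * eval p b') ∨
    ∃ t, .inr (.inr (.inr t)) ≠ y ∧ ∀ p, c p = 0 → d p = 0 → eval p (l t) = 0 := by
  obtain ⟨⟨hQ, -⟩, hPs, -, hl, -, hrad, -⟩ := hset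
  have hF : ∀ k, (QoFam Q P Fin.elim0 l k).IsHomogeneous 2 := by
    rintro (_ | j | i | t)
    · exact hQ
    · exact (hPs j).1
    · exact i.elim0
    · exact (hl t).pow 2
  obtain ⟨k, hkx, hky, α, hk⟩ := exists_eqOn_smul hF hrk ha' hb' hx (hrad x y hxy) c d s
    (by rwa [hx])
  rw [hx] at hk
  obtain _ | k | i | t := k
  · refine .inl ⟨hkx.symm, ?_⟩
    have := mul_eqOn_of_eqOn_smul hQ hrk c d ha' hb' (isHomogeneous_zero _ _ 1)
      (isHomogeneous_zero _ _ 1) (by simpa [QoFam] using hk)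
    simpa [eq_comm] using this
  · exact .inr (.inl ⟨k, hkx, hky, mul_eqOn_of_eqOn_smul hQ hrk c d ha' hb' (ha k) (hb k)
      (by simpa [QoFam, hP] using hk)⟩)
  · exact i.elim0
  · exact .inr (.inr ⟨t, hky, eqOn_zero_of_sq_eqOn_smul hQ hrk c d ha' hb' (hl t)
      (by simpa [QoFam] using hk)⟩)

theorem exists_mul_eqOn_zero (hset : IsQoSet m 0 r Q P Fin.elim0 l) (hrk : 100 ≤ rankS Q)
    (ha : ∀ j, (a j).IsHomogeneous 1) (hb : ∀ j, (b j).IsHomogeneous 1)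
    (hP : ∀ j, P j = Q + a j * b j) (t : Fin r) :
    ∃ k, ∀ p, eval p (l t) = 0 → eval p (a k) * eval p (b k) = 0 := by
  have hl := hset.2.2.2.1
  have hli := hset.2.2.2.2.1
  obtain ⟨h, -⟩ | ⟨k, -, -, hk⟩ | ⟨u, hu, h⟩ := exists_third_member hset hrk ha hb hP
    (x := .inl ()) (y := .inr (.inr (.inr t))) (by simp) (isHomogeneous_zero _ _ 1)
    (isHomogeneous_zero _ _ 1) (by simp [QoFam]) (toDual (l t)) 0 0
    (fun p h _ => by rw [toDual_apply (hl t)] at h; simp [QoFam, h])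
  · exact absurd rfl h
  · exact ⟨k, fun p hp => by simpa using hk p (by rwa [toDual_apply (hl t)]) rfl⟩
  · exfalso
    obtain ⟨e, he⟩ := exists_eq_smul_of_eqOn_zero (hl t) (hl u) fun p hp =>
      h p (by rwa [toDual_apply (hl t)]) rfl
    have := LinearIndependent.pair_iff.1 (hli _ _ hu) (-1) (e ^ 2) (by
      simp [QoFam, he, smul_pow])
    simp at this

theorem isProductConfiguration (hset : IsQoSet m 0 r Q P Fin.elim0 l) (hrk : 100 ≤ rankS Q)
    (ha : ∀ j, (a j).IsHomogeneous 1) (hb : ∀ j, (b j).IsHomogeneous 1)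
    (hP : ∀ j, P j = Q + a j * b j) :
    IsProductConfiguration (fun j => toDual (a j)) (fun j => toDual (b j)) := by
  have hl := hset.2.2.2.1
  have hli := hset.2.2.2.2.1
  have hne : ∀ j, a j * b j ≠ 0 := fun j h0 => by
    have := LinearIndependent.pair_iff.1 (hli (.inl ()) (.inr (.inl j)) (by simp)) 1 (-1) (by
      simp [QoFam, hP, h0])
    simp at this
  have hzero : ∀ f : MvPolynomial (Fin n) ℂ, f.IsHomogeneous 1 → toDual f = 0 → f = 0 :=
    fun f hf h0 => MvPolynomial.funext fun p => by rw [← toDual_apply hf, h0]; simp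
  refine ⟨fun j h => hne j ?_, fun j h => hne j ?_, fun i j hij h => ?_, fun c d i j hij h => ?_⟩
  · rw [hzero _ (ha j) h, zero_mul]
  · rw [hzero _ (hb j) h, mul_zero]
  · simp only [toDual_apply (ha _), toDual_apply (hb _), ← map_mul] at h
    have := LinearIndependent.pair_iff.1
      (hli (.inr (.inl i)) (.inr (.inl j)) (by simpa using hij)) 1 (-1) (by
        simp only [QoFam, hP, Sum.elim_inr, Sum.elim_inl, MvPolynomial.funext h, one_smul,
          neg_smul, add_neg_cancel])
    simp at this
  · simp only [toDual_apply (ha _), toDual_apply (hb _)] at h ⊢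
    obtain ⟨-, h0⟩ | ⟨k, hki, hkj, hk⟩ | ⟨t, -, ht⟩ := exists_third_member hset hrk ha hb hP
      (x := .inr (.inl i)) (y := .inr (.inl j)) (by simpa using hij) (ha i) (hb i)
      (by simp [QoFam, hP]) c d 1 (fun p h1 h2 => by simp [QoFam, hP, h p h1 h2])
    · exact .inl h0
    · exact .inr ⟨k, by simpa using hki, by simpa using hkj, .inl hk⟩
    · obtain ⟨k, hk⟩ := exists_mul_eqOn_zero hset hrk ha hb hP t
      by_cases hki : k = i
      · exact .inl fun p h1 h2 => hki ▸ hk p (ht p h1 h2)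
      by_cases hkj : k = j
      · exact .inl fun p h1 h2 => by rw [h p h1 h2]; exact hkj ▸ hk p (ht p h1 h2)
      · exact .inr ⟨k, hki, hkj, .inr fun p h1 h2 => hk p (ht p h1 h2)⟩

theorem finrank_span_linear_forms_le_four (hset : IsQoSet m 0 r Q P Fin.elim0 l)
    (hrk : 100 ≤ rankS Q) (ha : ∀ j, (a j).IsHomogeneous 1) (hb : ∀ j, (b j).IsHomogeneous 1)
    (hP : ∀ j, P j = Q + a j * b j) :
    finrank ℂ (Submodule.span ℂ (Set.range a ∪ Set.range b ∪ Set.range l)) ≤ 4 := by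
  have hC := isProductConfiguration hset hrk ha hb hP
  have hl := hset.2.2.2.1
  have hspan : Submodule.span ℂ (Set.range a ∪ Set.range b ∪ Set.range l) =
      Submodule.span ℂ (Set.range a ∪ Set.range b) := by
    refine le_antisymm (Submodule.span_le.2 (Set.union_subset Submodule.subset_span ?_))
      (Submodule.span_mono Set.subset_union_left)
    rintro _ ⟨t, rfl⟩
    obtain ⟨k, hk⟩ := exists_mul_eqOn_zero hset hrk ha hb hP t
    have key : ∀ f : MvPolynomial (Fin n) ℂ, f.IsHomogeneous 1 → toDual f ≠ 0 →
        (∀ p, toDual (l t) p = 0 → (0 : Dual ℂ (Fin n → ℂ)) p = 0 → toDual f p = 0) →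
        f ∈ Set.range a ∪ Set.range b →
        l t ∈ Submodule.span ℂ (Set.range a ∪ Set.range b) := by
      intro f hf hf0 h hfab
      obtain ⟨e, rfl⟩ := exists_eq_smul_of_eqOn_zero (hl t) hf fun p hp => by
        rw [← toDual_apply hf]
        exact h p (by rwa [toDual_apply (hl t)]) rfl
      have he : e ≠ 0 := by rintro rfl; simp at hf0
      rw [← Submodule.smul_mem_iff _ he]
      exact Submodule.subset_span hfab
    obtain h | h := forall_mem_eq_zero_or_of_mul_eq_zero (toDual (l t)) 0 (toDual (a k))
      (toDual (b k)) fun p hp _ => by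
        rw [toDual_apply (hl t)] at hp
        rw [toDual_apply (ha k), toDual_apply (hb k), hk p hp]
    · exact key _ (ha k) (hC.left_ne_zero k) h (.inl ⟨k, rfl⟩)
    · exact key _ (hb k) (hC.right_ne_zero k) h (.inr ⟨k, rfl⟩)
  rw [hspan]
  have hhom : Submodule.span ℂ (Set.range a ∪ Set.range b) ≤
      homogeneousSubmodule (Fin n) ℂ 1 := by
    rw [Submodule.span_le]
    rintro _ (⟨j, rfl⟩ | ⟨j, rfl⟩)
    exacts [ha j, hb j]
  have hinj : Function.Injective
      (toDual.domRestrict (Submodule.span ℂ (Set.range a ∪ Set.range b))) := by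
    rw [← LinearMap.ker_eq_bot, LinearMap.ker_eq_bot']
    rintro ⟨f, hf⟩ h0
    refine Subtype.ext (MvPolynomial.funext fun p => ?_)
    rw [← toDual_apply (hhom hf)]
    exact (LinearMap.congr_fun h0 p).trans (by simp)
  rw [← LinearMap.finrank_range_of_inj hinj, LinearMap.range_domRestrict, Submodule.map_span,
    Set.image_union, ← Set.range_comp, ← Set.range_comp]
  exact hC.finrank_span_le_four

end Configuration

end MvPolynomial

/-- Claim 5.3 of the paper. For a `(Q_o,m₁,0)`-set with
`rank_s(Q_o) ≥ 100`, where `Q_j = Q_o + a_j·b_j` and `ℒ = {ℓ_t²}`, the span of all the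
linear forms `a_j, b_j, ℓ_t` has dimension at most `7`; in particular the span of the
whole set has dimension at most `29`. -/
theorem statement15 {n m₁ r : ℕ} (Qo : MvPolynomial (Fin n) ℂ)
    (Qs : Fin m₁ → MvPolynomial (Fin n) ℂ) (ls : Fin r → MvPolynomial (Fin n) ℂ)
    (a b : Fin m₁ → MvPolynomial (Fin n) ℂ)
    (hset : IsQoSet m₁ 0 r Qo Qs (Fin.elim0 : Fin 0 → MvPolynomial (Fin n) ℂ) ls)
    (hrk : 100 ≤ rankS Qo)
    (ha : ∀ j, (a j).IsHomogeneous 1) (hb : ∀ j, (b j).IsHomogeneous 1)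
    (hQ : ∀ j, Qs j = Qo + a j * b j) :
    Module.finrank ℂ
        (Submodule.span ℂ (Set.range a ∪ Set.range b ∪ Set.range ls)) ≤ 7 ∧
    Module.finrank ℂ
        (Submodule.span ℂ
          (Set.range (QoFam Qo Qs (Fin.elim0 : Fin 0 → MvPolynomial (Fin n) ℂ) ls)))
      ≤ 29 := by
  have h4 := MvPolynomial.finrank_span_linear_forms_le_four hset hrk ha hb hQ
  refine ⟨h4.trans (by norm_num), ?_⟩
  set S := Submodule.span ℂ (Set.range a ∪ Set.range b ∪ Set.range ls)
  have hsub : Set.range a ∪ Set.range b ∪ Set.range ls ⊆ S := Submodule.subset_span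
  have : FiniteDimensional ℂ S := FiniteDimensional.span_of_finite ℂ
    (((Set.finite_range a).union (Set.finite_range b)).union (Set.finite_range ls))
  have : FiniteDimensional ℂ ↥(S * S) := by
    rw [← Submodule.mulMap_range]
    infer_instance
  have hmul : Module.finrank ℂ ↥(S * S) ≤ 16 := by
    rw [← Submodule.mulMap_range]
    refine (LinearMap.finrank_range_le _).trans ?_
    rw [Module.finrank_tensorProduct]
    exact Nat.mul_le_mul h4 h4
  have hle : Submodule.span ℂ (Set.range (QoFam Qo Qs Fin.elim0 ls)) ≤
      Submodule.span ℂ {Qo} ⊔ S * S := by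
    have hQo : Qo ∈ Submodule.span ℂ {Qo} ⊔ S * S :=
      Submodule.mem_sup_left (Submodule.mem_span_singleton_self Qo)
    rw [Submodule.span_le]
    rintro _ ⟨_ | j | i | t, rfl⟩
    · exact hQo
    · simp only [QoFam, Sum.elim_inr, Sum.elim_inl, hQ]
      exact Submodule.add_mem _ hQo (Submodule.mem_sup_right (Submodule.mul_mem_mul
        (hsub (.inl (.inl ⟨j, rfl⟩))) (hsub (.inl (.inr ⟨j, rfl⟩)))))
    · exact i.elim0
    · simp only [QoFam, Sum.elim_inr, sq]
      exact Submodule.mem_sup_right (Submodule.mul_mem_mul (hsub (.inr ⟨t, rfl⟩))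
        (hsub (.inr ⟨t, rfl⟩)))
  have hone := finrank_span_singleton (K := ℂ) hset.1.2.ne_zero
  have hadd := Submodule.finrank_add_le_finrank_add_finrank (Submodule.span ℂ {Qo}) (S * S)
  have := Submodule.finrank_mono hle
  omega
end

section
/- Let 𝒬̃ = 𝒬₁ ∪ ℒ ⊆ ℂ[x₁,…,xₙ] be a (Q_o,m₁,0)-set with rank_s(Q_o) ≥ 100, where Q_j = Q_o + a_j·b_j for j ∈ {1,…,m₁} and ℒ = {ℓ₁²,…,ℓ_r²}; adopt the convention a_{m₁+t} = b_{m₁+t} = ℓ_t for t ∈ {1,…,r}. Let Q_i = Q_o + a_i·b_i and Q_j = Q_o + a_j·b_j be two elements of 𝒬₁ (i ≠ j). Then: (1) if some element Q_k of 𝒬̃ ∖ {Q_i,Q_j} lies in span_ℂ{Q_i, Q_j}, then there exist α, β ∈ ℂ ∖ {0} and k ∈ {1,…,m₁+r} with α·a_i·b_i + β·a_j·b_j = a_k·b_k; (2) if there exist (α,β) ∈ ℂ² ∖ {(0,0)} and linear forms c', d' with α·Q_i + β·Q_j = c'·d', then there exist linear forms c, d with a_i·b_i − a_j·b_j = c·d.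 (The paper assumes rank_s(Q_o) ≥ rkq for an arbitrary sufficiently large absolute constant rkq; rkq = 100 suffices.) -/
open MvPolynomial

/-- A quadratic of large `rankS` has no nonzero multiple that is a sum of three products of
linear forms. -/
lemma eq_zero_of_smul_eq_sum_three {σ : Type*} {Q : MvPolynomial σ ℂ} (hrk : 3 < rankS Q)
    {t : ℂ} {x₁ y₁ x₂ y₂ x₃ y₃ : MvPolynomial σ ℂ}
    (hx₁ : x₁.IsHomogeneous 1) (hy₁ : y₁.IsHomogeneous 1)
    (hx₂ : x₂.IsHomogeneous 1) (hy₂ : y₂.IsHomogeneous 1)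
    (hx₃ : x₃.IsHomogeneous 1) (hy₃ : y₃.IsHomogeneous 1)
    {u₁ u₂ u₃ : ℂ} (h : t • Q = u₁ • (x₁ * y₁) + u₂ • (x₂ * y₂) + u₃ • (x₃ * y₃)) :
    t = 0 := by
  by_contra ht
  refine absurd hrk (not_lt.mpr (Nat.sInf_le ?_))
  have hC : ∀ (c : ℂ) {x : MvPolynomial σ ℂ}, x.IsHomogeneous 1 → (c • x).IsHomogeneous 1 :=
    fun c _ hx => (homogeneousSubmodule σ ℂ 1).smul_mem c hx
  refine ⟨![(t⁻¹ * u₁) • x₁, (t⁻¹ * u₂) • x₂, (t⁻¹ * u₃) • x₃], ![y₁, y₂, y₃], ?_, ?_, ?_⟩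
  · intro i
    fin_cases i
    · exact hC _ hx₁
    · exact hC _ hx₂
    · exact hC _ hx₃
  · intro i
    fin_cases i
    · exact hy₁
    · exact hy₂
    · exact hy₃
  · calc Q = t⁻¹ • (t • Q) := (inv_smul_smul₀ ht Q).symm
      _ = _ := by
        rw [h]
        simp [Fin.sum_univ_three, smul_add, smul_smul]

/-- Claim 5.4 of the paper. Let `𝒬̃` be a `(Q_o,m₁,0)`-set with
`rank_s(Q_o) ≥ 100`, `Q_j = Q_o + a_j·b_j`, with the convention that for
`t ∈ {1,…,r}` the pair `(a_{m₁+t}, b_{m₁+t})` is `(ℓ_t, ℓ_t)` (encoded by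
`Sum.elim a ls` and `Sum.elim b ls`). Then for `i ≠ j` in `{1,…,m₁}`:
(1) if some other element of `𝒬̃` lies in `span{Q_i, Q_j}` then
`α·a_i·b_i + β·a_j·b_j = a_k·b_k` for some nonzero `α, β` and some `k`;
(2) if a nontrivial combination of `Q_i, Q_j` is a product of two linear forms then
`a_i·b_i − a_j·b_j` is a product of two linear forms. -/
theorem statement16 {n m₁ r : ℕ} (Qo : MvPolynomial (Fin n) ℂ)
    (Qs : Fin m₁ → MvPolynomial (Fin n) ℂ) (ls : Fin r → MvPolynomial (Fin n) ℂ)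
    (a b : Fin m₁ → MvPolynomial (Fin n) ℂ)
    (hset : IsQoSet m₁ 0 r Qo Qs (Fin.elim0 : Fin 0 → MvPolynomial (Fin n) ℂ) ls)
    (hrk : 100 ≤ rankS Qo)
    (ha : ∀ j, (a j).IsHomogeneous 1) (hb : ∀ j, (b j).IsHomogeneous 1)
    (hQ : ∀ j, Qs j = Qo + a j * b j)
    (i j : Fin m₁) (hij : i ≠ j) :
    ((∃ k : Unit ⊕ Fin m₁ ⊕ Fin 0 ⊕ Fin r,
        k ≠ Sum.inr (Sum.inl i) ∧ k ≠ Sum.inr (Sum.inl j) ∧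
        QoFam Qo Qs (Fin.elim0 : Fin 0 → MvPolynomial (Fin n) ℂ) ls k ∈
          Submodule.span ℂ {Qs i, Qs j}) →
      ∃ α β : ℂ, α ≠ 0 ∧ β ≠ 0 ∧ ∃ k : Fin m₁ ⊕ Fin r,
        α • (a i * b i) + β • (a j * b j) = Sum.elim a ls k * Sum.elim b ls k) ∧
    ((∃ α β : ℂ, ¬(α = 0 ∧ β = 0) ∧
        ∃ c' d' : MvPolynomial (Fin n) ℂ, c'.IsHomogeneous 1 ∧ d'.IsHomogeneous 1 ∧
          α • Qs i + β • Qs j = c' * d') →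
      ∃ c d : MvPolynomial (Fin n) ℂ, c.IsHomogeneous 1 ∧ d.IsHomogeneous 1 ∧
        a i * b i - a j * b j = c * d) := by
  obtain ⟨-, -, -, hls, hind, -⟩ := hset
  have h3 : 3 < rankS Qo := by omega
  have hz := (isHomogeneous_zero (Fin n) ℂ 1)
  have hne : ∀ k l, k ≠ l → QoFam Qo Qs (Fin.elim0 : Fin 0 → MvPolynomial (Fin n) ℂ) ls k ≠
      QoFam Qo Qs (Fin.elim0 : Fin 0 → MvPolynomial (Fin n) ℂ) ls l := by
    intro k l hkl he
    have := (hind k l hkl).injective (a₁ := 0) (a₂ := 1) (by simpa using he)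
    simp at this
  constructor
  · rintro ⟨k, hki, hkj, hk⟩
    obtain ⟨α, β, hk⟩ := Submodule.mem_span_pair.mp hk
    have hα : α • Qs i = α • Qo + α • (a i * b i) := by rw [hQ i, smul_add]
    have hβ : β • Qs j = β • Qo + β • (a j * b j) := by rw [hQ j, smul_add]
    rcases k with u | k | k | t
    · -- here `a i * b i` and `a j * b j` are proportional
      change α • Qs i + β • Qs j = Qo at hk
      have hsum : α + β - 1 = 0 :=
        eq_zero_of_smul_eq_sum_three h3 (ha i) (hb i) (ha j) (hb j) hz hz
          (u₁ := -α) (u₂ := -β) (u₃ := 0) (by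
            rw [hα, hβ] at hk
            linear_combination (norm := module) hk)
      have hβ' : β = 1 - α := by linear_combination hsum
      have hrel : α • (a i * b i) + (1 - α) • (a j * b j) = 0 := by
        rw [hα, hβ, hβ'] at hk
        linear_combination (norm := module) hk
      have hα0 : α ≠ 0 := by
        rintro rfl
        exact hne _ _ hkj (by simpa [QoFam, hβ'] using hk.symm)
      have hα1 : 1 - α ≠ 0 := by
        intro h1
        have h1' : α = 1 := by linear_combination -h1
        rw [hβ', h1'] at hk
        exact hne _ _ hki (by simpa [QoFam] using hk.symm)
      refine ⟨2, α⁻¹ * (1 - α), two_ne_zero, mul_ne_zero (inv_ne_zero hα0) hα1, Sum.inl i, ?_⟩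
      have hrel' := congrArg (α⁻¹ • ·) hrel
      simp only [smul_add, smul_smul, inv_mul_cancel₀ hα0, smul_zero, one_smul] at hrel'
      simp only [Sum.elim_inl]
      linear_combination (norm := module) hrel'
    · change α • Qs i + β • Qs j = Qs k at hk
      have hsum : α + β - 1 = 0 :=
        eq_zero_of_smul_eq_sum_three h3 (ha i) (hb i) (ha j) (hb j) (ha k) (hb k)
          (u₁ := -α) (u₂ := -β) (u₃ := 1) (by
            rw [hα, hβ, hQ k] at hk
            linear_combination (norm := module) hk)
      have hβ' : β = 1 - α := by linear_combination hsum
      refine ⟨α, β, ?_, ?_, Sum.inl k, ?_⟩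
      · rintro rfl
        exact hne _ _ hkj (by simpa [QoFam, hβ'] using hk.symm)
      · intro hβ0
        have h1' : α = 1 := by linear_combination hsum - hβ0
        rw [hβ0, h1'] at hk
        exact hne _ _ hki (by simpa [QoFam] using hk.symm)
      · rw [hα, hβ, hQ k, hβ'] at hk
        rw [hβ']
        simp only [Sum.elim_inl]
        linear_combination (norm := module) hk
    · exact k.elim0
    · change α • Qs i + β • Qs j = ls t ^ 2 at hk
      have hsum : α + β = 0 :=
        eq_zero_of_smul_eq_sum_three h3 (ha i) (hb i) (ha j) (hb j) (hls t) (hls t)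
          (u₁ := -α) (u₂ := -β) (u₃ := 1) (by
            rw [hα, hβ, sq] at hk
            linear_combination (norm := module) hk)
      have hβ' : β = -α := by linear_combination hsum
      have hα0 : α ≠ 0 := by
        rintro rfl
        have h0 : ls t ^ 2 = 0 := by rw [← hk, hβ']; simp
        exact (hind _ _ hki).ne_zero 0 (by simpa [QoFam] using h0)
      refine ⟨α, β, hα0, by simpa [hβ'] using hα0, Sum.inr t, ?_⟩
      rw [hα, hβ, hβ', sq] at hk
      rw [hβ']
      simp only [Sum.elim_inr]
      linear_combination (norm := module) hk
  · rintro ⟨α, β, h0, c, d, hc, hd, h⟩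
    have hsum : α + β = 0 :=
      eq_zero_of_smul_eq_sum_three h3 (ha i) (hb i) (ha j) (hb j) hc hd
        (u₁ := -α) (u₂ := -β) (u₃ := 1) (by
          rw [hQ i, hQ j] at h
          linear_combination (norm := module) h)
    have hβ' : β = -α := by linear_combination hsum
    have hα0 : α ≠ 0 := fun h1 => h0 ⟨h1, by rw [hβ', h1, neg_zero]⟩
    refine ⟨α⁻¹ • c, d, (homogeneousSubmodule _ ℂ 1).smul_mem _ hc, hd, ?_⟩
    rw [smul_mul_assoc, ← h, eq_inv_smul_iff₀ hα0, hβ', hQ i, hQ j]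
    module
end

section
/- Let 𝒬̃ = 𝒬₁ ∪ ℒ ⊆ ℂ[x₁,…,xₙ] be a (Q_o,m₁,0)-set with rank_s(Q_o) ≥ 100, where Q_j = Q_o + a_j·b_j for j ∈ {1,…,m₁} and ℒ = {ℓ₁²,…,ℓ_r²}; adopt the convention a_{m₁+t} = b_{m₁+t} = ℓ_t for t ∈ {1,…,r}. If dim span_ℂ{a_i, b_i : i ∈ {1,…,m₁+r}} > 3, then there exists a space V of linear forms with dim V ≤ 4 such that for every i ∈ {1,…,m₁+r}, either b_i ∈ span_ℂ({a_i} ∪ V) or a_i ∈ span_ℂ({b_i} ∪ V). (The paper assumes rank_s(Q_o) ≥ rkq for an arbitrary sufficiently large absolute constant rkq; rkq = 100 suffices.) -/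
open MvPolynomial

section LinearAlgebra

variable {W : Type*} [AddCommGroup W] [Module ℂ W]

/-- A quadratic form that is nonzero on every subspace cut out by eight linear forms has, on a
subspace cut out by four linear forms, an isotropic vector outside its radical. -/
lemma exists_isotropic_of_nondegenerate (B : W →ₗ[ℂ] W →ₗ[ℂ] ℂ) (hsymm : ∀ u v, B u v = B v u)
    (hB : ∀ ψ : Fin 8 → W →ₗ[ℂ] ℂ, ∃ h, (∀ i, ψ i h = 0) ∧ B h h ≠ 0)
    (φ : Fin 4 → W →ₗ[ℂ] ℂ) :
    ∃ e p, (∀ i, φ i e = 0) ∧ (∀ i, φ i p = 0) ∧ B e e = 0 ∧ B p e ≠ 0 := by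
  obtain ⟨p, hp, hpp⟩ := hB ![φ 0, φ 1, φ 2, φ 3, 0, 0, 0, 0]
  obtain ⟨q, hq, hqq⟩ := hB ![φ 0, φ 1, φ 2, φ 3, B p, 0, 0, 0]
  have hφp : ∀ i, φ i p = 0 := by
    intro i; fin_cases i
    exacts [hp 0, hp 1, hp 2, hp 3]
  have hφq : ∀ i, φ i q = 0 := by
    intro i; fin_cases i
    exacts [hq 0, hq 1, hq 2, hq 3]
  have hpq : B p q = 0 := hq 4
  have hqp : B q p = 0 := by rw [hsymm, hpq]
  obtain ⟨μ, hμ⟩ := IsAlgClosed.exists_pow_nat_eq (-(B p p) / B q q) (n := 2) (by norm_num)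
  refine ⟨p + μ • q, p, fun i => by simp [hφp, hφq], hφp, ?_, by simpa [hpq] using hpp⟩
  have : μ ^ 2 * B q q = -(B p p) := by rw [hμ]; field_simp
  simp only [map_add, map_smul, LinearMap.add_apply, LinearMap.smul_apply, hpq, hqp, smul_eq_mul]
  linear_combination this

/-- An identity `α β = k φ₀ φ₁` that holds on the generic part of the quadric
`B w w + φ₀ w φ₁ w = 0` inside the cone `φ₀ φ₁ = φ₂ φ₃` holds on the whole cone. -/
lemma mul_eq_on_cone_of_mul_eq_on_quadric (B : W →ₗ[ℂ] W →ₗ[ℂ] ℂ)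
    (hsymm : ∀ u v, B u v = B v u)
    (hB : ∀ ψ : Fin 8 → W →ₗ[ℂ] ℂ, ∃ h, (∀ i, ψ i h = 0) ∧ B h h ≠ 0)
    (φ : Fin 4 → W →ₗ[ℂ] ℂ) {e p : W} (hp : ∀ i, φ i p = 0)
    (hpe : B p e ≠ 0) (α β : W →ₗ[ℂ] ℂ) (k : ℂ)
    (H : ∀ (w : W) (c : Fin 4 → ℂ),
      (φ 0 w = c 0 * c 2 ∧ φ 1 w = c 1 * c 3 ∧ φ 2 w = c 0 * c 3 ∧ φ 3 w = c 1 * c 2) →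
      B w w + φ 0 w * φ 1 w = 0 → B w e ≠ 0 → α w * β w = k * (φ 0 w * φ 1 w))
    (w : W) (c : Fin 4 → ℂ)
    (hw : φ 0 w = c 0 * c 2 ∧ φ 1 w = c 1 * c 3 ∧ φ 2 w = c 0 * c 3 ∧ φ 3 w = c 1 * c 2) :
    α w * β w = k * (φ 0 w * φ 1 w) := by
  have generic : ∀ w : W,
      (φ 0 w = c 0 * c 2 ∧ φ 1 w = c 1 * c 3 ∧ φ 2 w = c 0 * c 3 ∧ φ 3 w = c 1 * c 2) →
      B w e ≠ 0 → α w * β w = k * (φ 0 w * φ 1 w) := by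
    intro w hw hwe
    obtain ⟨h, hψ, hh⟩ := hB ![φ 0, φ 1, φ 2, φ 3, α, β, B e, B w]
    have h0 : φ 0 h = 0 := hψ 0
    have h1 : φ 1 h = 0 := hψ 1
    have h2 : φ 2 h = 0 := hψ 2
    have h3 : φ 3 h = 0 := hψ 3
    have h4 : α h = 0 := hψ 4
    have h5 : β h = 0 := hψ 5
    have h6 : B h e = 0 := by rw [hsymm]; exact hψ 6
    have h7 : B w h = 0 := hψ 7
    have h8 : B h w = 0 := by rw [hsymm, h7]
    obtain ⟨μ, hμ⟩ := IsAlgClosed.exists_pow_nat_eq (-(B w w + φ 0 w * φ 1 w) / B h h)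
      (n := 2) (by norm_num)
    have hμ' : μ ^ 2 * B h h = -(B w w + φ 0 w * φ 1 w) := by rw [hμ]; field_simp
    have := H (w + μ • h) c (by simpa [h0, h1, h2, h3] using hw)
      (by
        simp only [map_add, map_smul, LinearMap.add_apply, LinearMap.smul_apply, h0, h1, h7, h8,
          smul_eq_mul]
        linear_combination hμ')
      (by simpa [h6] using hwe)
    simpa [h0, h1, h4, h5] using this
  have line : ∀ t : ℂ, B w e + t * B p e ≠ 0 →
      α w * β w + t * (α w * β p + α p * β w) + t ^ 2 * (α p * β p) = k * (φ 0 w * φ 1 w) := by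
    intro t ht
    have := generic (w + t • p) (by simpa [hp] using hw) (by simpa using ht)
    simp only [map_add, map_smul, smul_eq_mul, hp] at this
    linear_combination this
  -- values of a quadratic polynomial in `t` near the excluded parameter determine it
  by_cases h0 : B w e = 0
  · have aux : ∀ t : ℂ, t ≠ 0 → B w e + t * B p e ≠ 0 := by
      intro t ht; rw [h0, zero_add]; exact mul_ne_zero ht hpe
    have e1 := line 1 (aux 1 (by norm_num))
    have e2 := line 2 (aux 2 (by norm_num))
    have e3 := line 3 (aux 3 (by norm_num))
    linear_combination 3 * e1 - 3 * e2 + e3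
  · have := line 0 (by simpa using h0)
    linear_combination this

/-- If `α β` agrees with `φ₀ φ₁` on the cone `φ₀ φ₁ = φ₂ φ₃`,
then `α β` equals `φ₀ φ₁` or `φ₂ φ₃`. -/
lemma mul_eq_or_mul_eq_of_mul_eq_on_cone (φ : Fin 4 → W →ₗ[ℂ] ℂ) (f : Fin 4 → W)
    (hf : ∀ i j, φ i (f j) = if i = j then 1 else 0) (α β : W →ₗ[ℂ] ℂ)
    (H : ∀ (w : W) (c : Fin 4 → ℂ),
      (φ 0 w = c 0 * c 2 ∧ φ 1 w = c 1 * c 3 ∧ φ 2 w = c 0 * c 3 ∧ φ 3 w = c 1 * c 2) →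
      α w * β w = φ 0 w * φ 1 w) :
    (∀ w, α w * β w = φ 0 w * φ 1 w) ∨ (∀ w, α w * β w = φ 2 w * φ 3 w) := by
  have K : ∀ (s t u v : ℂ) (r : W), (∀ i, φ i r = 0) →
      (s * u * α (f 0) + t * v * α (f 1) + s * v * α (f 2) + t * u * α (f 3) + α r) *
      (s * u * β (f 0) + t * v * β (f 1) + s * v * β (f 2) + t * u * β (f 3) + β r) =
        s * u * (t * v) := by
    intro s t u v r hr
    have := H ((s * u) • f 0 + (t * v) • f 1 + (s * v) • f 2 + (t * u) • f 3 + r) ![s, t, u, v]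
      (by simp [hf, hr])
    simpa [hf, hr] using this
  have decomp : ∀ w, ∀ i, φ i (w - ∑ j, φ j w • f j) = 0 := by
    intro w i
    simp [hf]
  have hU : ∀ r, (∀ i, φ i r = 0) → α r = 0 ∧ β r = 0 := by
    intro r hr
    have e0 := K 1 1 1 1 0 (by simp)
    have e1 := K 1 1 1 1 r hr
    have e2 := K 1 1 1 1 (-r) (by simpa using hr)
    have e3 := K 0 0 0 0 r hr
    simp only [map_neg, map_zero] at *
    grind
  have expand : ∀ (γ : W →ₗ[ℂ] ℂ), (∀ r, (∀ i, φ i r = 0) → γ r = 0) → ∀ w,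
      γ w = φ 0 w * γ (f 0) + φ 1 w * γ (f 1) + φ 2 w * γ (f 2) + φ 3 w * γ (f 3) := by
    intro γ hγ w
    have := hγ _ (decomp w)
    simp only [Fin.sum_univ_four, map_sub, map_add, map_smul, smul_eq_mul] at this
    linear_combination this
  have hα := expand α fun r hr => (hU r hr).1
  have hβ := expand β fun r hr => (hU r hr).2
  have K0 : ∀ s t u v : ℂ, _ := fun s t u v => K s t u v 0 (by simp)
  simp only [map_zero, add_zero] at K0
  generalize α (f 0) = a0 at *
  generalize α (f 1) = a1 at *
  generalize α (f 2) = a2 at *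
  generalize α (f 3) = a3 at *
  generalize β (f 0) = b0 at *
  generalize β (f 1) = b1 at *
  generalize β (f 2) = b2 at *
  generalize β (f 3) = b3 at *
  have c00 : a0 * b0 = 0 := by linear_combination K0 1 0 1 0
  have c11 : a1 * b1 = 0 := by linear_combination K0 0 1 0 1
  have c22 : a2 * b2 = 0 := by linear_combination K0 1 0 0 1
  have c33 : a3 * b3 = 0 := by linear_combination K0 0 1 1 0
  have c02 : a0 * b2 + a2 * b0 = 0 := by linear_combination K0 1 0 1 1 - c00 - c22
  have c03 : a0 * b3 + a3 * b0 = 0 := by linear_combination K0 1 1 1 0 - c00 - c33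
  have c12 : a1 * b2 + a2 * b1 = 0 := by linear_combination K0 1 1 0 1 - c11 - c22
  have c13 : a1 * b3 + a3 * b1 = 0 := by linear_combination K0 0 1 1 1 - c11 - c33
  have c01 : a0 * b1 + a1 * b0 + (a2 * b3 + a3 * b2) = 1 := by
    linear_combination K0 1 1 1 1 - c00 - c11 - c22 - c33 - c02 - c03 - c12 - c13
  have hc : a0 * b1 + a1 * b0 = 0 ∨ a0 * b1 + a1 * b0 = 1 := by grind
  rcases hc with hc | hc
  · right
    intro w
    rw [hα, hβ]
    have h23 : a2 * b3 + a3 * b2 = 1 := by linear_combination c01 - hc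
    linear_combination (φ 0 w) ^ 2 * c00 + (φ 1 w) ^ 2 * c11 + (φ 2 w) ^ 2 * c22 +
      (φ 3 w) ^ 2 * c33 + φ 0 w * φ 1 w * hc + φ 0 w * φ 2 w * c02 + φ 0 w * φ 3 w * c03 +
      φ 1 w * φ 2 w * c12 + φ 1 w * φ 3 w * c13 + φ 2 w * φ 3 w * h23
  · left
    intro w
    rw [hα, hβ]
    have h23 : a2 * b3 + a3 * b2 = 0 := by linear_combination c01 - hc
    linear_combination (φ 0 w) ^ 2 * c00 + (φ 1 w) ^ 2 * c11 + (φ 2 w) ^ 2 * c22 +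
      (φ 3 w) ^ 2 * c33 + φ 0 w * φ 1 w * hc + φ 0 w * φ 2 w * c02 + φ 0 w * φ 3 w * c03 +
      φ 1 w * φ 2 w * c12 + φ 1 w * φ 3 w * c13 + φ 2 w * φ 3 w * h23

/-- A linear form vanishing on the cone `φ₀ φ₁ = φ₂ φ₃` is zero. -/
lemma eq_zero_of_eq_zero_on_cone (φ : Fin 4 → W →ₗ[ℂ] ℂ) (f : Fin 4 → W)
    (hf : ∀ i j, φ i (f j) = if i = j then 1 else 0) (α : W →ₗ[ℂ] ℂ)
    (H : ∀ (w : W) (c : Fin 4 → ℂ),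
      (φ 0 w = c 0 * c 2 ∧ φ 1 w = c 1 * c 3 ∧ φ 2 w = c 0 * c 3 ∧ φ 3 w = c 1 * c 2) →
      α w = 0) (w : W) : α w = 0 := by
  have h0 := H (f 0) ![1, 0, 1, 0] (by simp [hf])
  have h1 := H (f 1) ![0, 1, 0, 1] (by simp [hf])
  have h2 := H (f 2) ![1, 0, 0, 1] (by simp [hf])
  have h3 := H (f 3) ![0, 1, 1, 0] (by simp [hf])
  have hw := H (w - ∑ j, φ j w • f j) 0 (by simp [hf])
  simpa [Fin.sum_univ_four, h0, h1, h2, h3] using hw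

end LinearAlgebra

section Polynomials

variable {n : ℕ}

lemma MvPolynomial.IsHomogeneous.exists_linearMap {a : MvPolynomial (Fin n) ℂ}
    (ha : a.IsHomogeneous 1) : ∃ α : (Fin n → ℂ) →ₗ[ℂ] ℂ, ∀ w, eval w a = α w := by
  rw [← mem_homogeneousSubmodule, homogeneousSubmodule_one_eq_span_X] at ha
  induction ha using Submodule.span_induction with
  | mem x hx =>
    obtain ⟨i, rfl⟩ := hx
    exact ⟨LinearMap.proj i, fun w => by simp⟩
  | zero => exact ⟨0, fun w => by simp⟩
  | add x y _ _ hx hy =>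
    obtain ⟨α, hα⟩ := hx
    obtain ⟨β, hβ⟩ := hy
    exact ⟨α + β, fun w => by simp [hα, hβ]⟩
  | smul c x _ hx =>
    obtain ⟨α, hα⟩ := hx
    exact ⟨c • α, fun w => by simp [hα, smul_eval]⟩

lemma exists_isHomogeneous_one_eval_eq (α : (Fin n → ℂ) →ₗ[ℂ] ℂ) :
    ∃ a : MvPolynomial (Fin n) ℂ, a.IsHomogeneous 1 ∧ ∀ w, eval w a = α w := by
  refine ⟨∑ i, C (α (Pi.single i 1)) * X i, ?_, fun w => ?_⟩
  · refine IsHomogeneous.sum _ _ _ fun i _ => ?_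
    simpa using (isHomogeneous_C (Fin n) (α (Pi.single i 1))).mul (isHomogeneous_X ℂ i)
  · rw [α.pi_apply_eq_sum_univ w]
    simp only [map_sum, map_mul, eval_C, eval_X, smul_eq_mul]
    refine Finset.sum_congr rfl fun i _ => ?_
    rw [mul_comm]
    congr 2
    ext j
    simp [Pi.single_apply, eq_comm]

lemma MvPolynomial.IsHomogeneous.exists_symm_bilinear {Q : MvPolynomial (Fin n) ℂ}
    (hQ : Q.IsHomogeneous 2) : ∃ B : (Fin n → ℂ) →ₗ[ℂ] (Fin n → ℂ) →ₗ[ℂ] ℂ,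
      (∀ u v, B u v = B v u) ∧ ∀ w, eval w Q = B w w := by
  rw [← mem_homogeneousSubmodule, ← homogeneousSubmodule_one_pow, pow_two] at hQ
  refine Submodule.mul_induction_on hQ (fun a ha b hb => ?_) fun x y hx hy => ?_
  · obtain ⟨α, hα⟩ := IsHomogeneous.exists_linearMap ha
    obtain ⟨β, hβ⟩ := IsHomogeneous.exists_linearMap hb
    refine ⟨(1 / 2 : ℂ) • (α.smulRight β + β.smulRight α), fun u v => ?_, fun w => ?_⟩
    · simp only [LinearMap.smul_apply, LinearMap.add_apply, LinearMap.smulRight_apply, smul_eq_mul]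
      ring
    · simp only [map_mul, hα, hβ, LinearMap.smul_apply, LinearMap.add_apply,
        LinearMap.smulRight_apply, smul_eq_mul]
      ring
  · obtain ⟨B, hB, hBx⟩ := hx
    obtain ⟨B', hB', hBy⟩ := hy
    exact ⟨B + B', fun u v => by simp [hB u v, hB' u v], fun w => by simp [hBx, hBy]⟩

/-- A linear map has a generalized inverse. -/
lemma LinearMap.exists_comp_comp_eq_self {K V V' : Type*} [Field K] [AddCommGroup V] [Module K V]
    [AddCommGroup V'] [Module K V'] (Φ : V →ₗ[K] V') : ∃ s : V' →ₗ[K] V, Φ ∘ₗ s ∘ₗ Φ = Φ := by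
  obtain ⟨g, hg⟩ := Φ.rangeRestrict.exists_rightInverse_of_surjective Φ.range_rangeRestrict
  obtain ⟨s, hs⟩ := g.exists_extend
  refine ⟨s, LinearMap.ext fun v => ?_⟩
  have h1 : s (Φ v) = g (Φ.rangeRestrict v) := LinearMap.congr_fun hs (Φ.rangeRestrict v)
  have h2 := congrArg Subtype.val (LinearMap.congr_fun hg (Φ.rangeRestrict v))
  simp only [LinearMap.comp_apply, h1]
  exact h2

/-- A quadratic form is nonzero somewhere on the common zeros of fewer than `rankS` linear
forms. -/
lemma exists_ne_zero_of_lt_rankS {Q : MvPolynomial (Fin n) ℂ} {k : ℕ} (hk : k < rankS Q)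
    {B : (Fin n → ℂ) →ₗ[ℂ] (Fin n → ℂ) →ₗ[ℂ] ℂ} (hsymm : ∀ u v, B u v = B v u)
    (hB : ∀ w, eval w Q = B w w) (ψ : Fin k → (Fin n → ℂ) →ₗ[ℂ] ℂ) :
    ∃ h, (∀ i, ψ i h = 0) ∧ B h h ≠ 0 := by
  by_contra! hzero
  obtain ⟨s, hs⟩ := (LinearMap.pi ψ).exists_comp_comp_eq_self
  have hs' : ∀ w i, ψ i (s (LinearMap.pi ψ w)) = ψ i w := fun w i =>
    congrFun (LinearMap.congr_fun hs w) i
  have key : ∀ w, B w w = ∑ i, ψ i w *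
      B ((2 : ℂ) • w - s (LinearMap.pi ψ w)) (s (Pi.single i 1)) := by
    intro w
    have h0 := hzero (w - s (LinearMap.pi ψ w)) fun i => by simp [hs']
    have hsum : s (LinearMap.pi ψ w) = ∑ i, ψ i w • s (Pi.single i 1) := by
      rw [s.pi_apply_eq_sum_univ]
      refine Finset.sum_congr rfl fun i _ => ?_
      congr 2
      ext j
      simp [Pi.single_apply, eq_comm]
    have h1 : B w w =
        B ((2 : ℂ) • w - s (LinearMap.pi ψ w)) (s (LinearMap.pi ψ w)) := by
      simp only [map_sub, map_smul, LinearMap.sub_apply, LinearMap.smul_apply, smul_eq_mul] at h0 ⊢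
      linear_combination h0 + hsymm (s (LinearMap.pi ψ w)) w
    rw [h1]
    generalize (2 : ℂ) • w - s (LinearMap.pi ψ w) = z
    rw [hsum]
    simp only [map_sum, map_smul, smul_eq_mul]
  choose c hc hcψ using fun i => exists_isHomogeneous_one_eval_eq (ψ i)
  choose d hd hdψ using fun i => exists_isHomogeneous_one_eval_eq
    (B.flip (s (Pi.single i 1)) ∘ₗ ((2 : ℂ) • LinearMap.id - s ∘ₗ LinearMap.pi ψ))
  refine absurd hk (not_lt.mpr (Nat.sInf_le ⟨c, d, hc, hd, MvPolynomial.funext fun w => ?_⟩))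
  rw [hB, key]
  simp [hcψ, hdψ]

/-- Linearly independent linear forms admit dual vectors. -/
lemma exists_dual_vectors {k : ℕ} (x : Fin k → MvPolynomial (Fin n) ℂ)
    (φ : Fin k → (Fin n → ℂ) →ₗ[ℂ] ℂ) (hφ : ∀ i w, eval w (x i) = φ i w)
    (hx : LinearIndependent ℂ x) :
    ∃ f : Fin k → (Fin n → ℂ), ∀ i j, φ i (f j) = if i = j then 1 else 0 := by
  have hli : LinearIndependent ℂ fun i => (φ i : (Fin n → ℂ) → ℂ) := by
    rw [Fintype.linearIndependent_iff] at hx ⊢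
    intro g hg
    refine hx g (MvPolynomial.funext fun w => ?_)
    simpa [smul_eval, hφ] using congrFun hg w
  rw [← span_flip_eq_top_iff_linearIndependent] at hli
  have hsurj : LinearMap.range (LinearMap.pi φ) = ⊤ := by
    rw [← hli, ← Submodule.span_eq (LinearMap.range (LinearMap.pi φ))]
    rfl
  rw [LinearMap.range_eq_top] at hsurj
  choose f hf using fun j => hsurj (Pi.single j 1)
  exact ⟨f, fun i j => by simpa [Pi.single_apply] using congrFun (hf j) i⟩

/-- Irreducibility of a parametrized variety: a product in the radical of `⟨F, G⟩` has a factor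
that vanishes along any polynomial parametrization of common zeros of `F` and `G`. -/
lemma exists_factor_vanishing {τ ι : Type*} (g : Fin n → MvPolynomial τ ℂ)
    {F G : MvPolynomial (Fin n) ℂ} (hF : ∀ p, eval (fun j => eval p (g j)) F = 0)
    (hG : ∀ p, eval (fun j => eval p (g j)) G = 0) (s : Finset ι)
    (P : ι → MvPolynomial (Fin n) ℂ) (h : ∏ k ∈ s, P k ∈ (Ideal.span {F, G}).radical) :
    ∃ k ∈ s, ∀ p, eval (fun j => eval p (g j)) (P k) = 0 := by
  have heval : ∀ (R : MvPolynomial (Fin n) ℂ) p,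
      eval p (bind₁ g R) = eval (fun j => eval p (g j)) R := by
    intro R p
    rw [← MvPolynomial.coe_aeval_eq_eval, ← MvPolynomial.coe_aeval_eq_eval]
    exact aeval_bind₁ _ _ _
  have hker : Ideal.span {F, G} ≤ RingHom.ker (bind₁ g) := by
    rw [Ideal.span_le]
    rintro R (rfl | rfl)
    · exact MvPolynomial.funext fun p => by rw [map_zero]; exact (heval _ p).trans (hF p)
    · exact MvPolynomial.funext fun p => by rw [map_zero]; exact (heval _ p).trans (hG p)
  obtain ⟨N, hN⟩ := h
  have hN' : bind₁ g (∏ k ∈ s, P k) ^ N = 0 := by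
    rw [← map_pow]; exact hker hN
  have hprod := eq_zero_of_pow_eq_zero hN'
  rw [map_prod, Finset.prod_eq_zero_iff] at hprod
  obtain ⟨k, hk, hk0⟩ := hprod
  exact ⟨k, hk, fun p => by rw [← heval, hk0, map_zero]⟩

end Polynomials

section Parametrization

variable {n : ℕ}

/-- The algebra of polynomial functions on `τ → ℂ`. -/
noncomputable def mvPolynomialFunctions (τ : Type*) : Subalgebra ℂ ((τ → ℂ) → ℂ) :=
  (AlgHom.pi fun p : τ → ℂ => (aeval p : MvPolynomial τ ℂ →ₐ[ℂ] ℂ)).range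

lemma mem_mvPolynomialFunctions {τ : Type*} {F : (τ → ℂ) → ℂ} :
    F ∈ mvPolynomialFunctions τ ↔ ∃ P : MvPolynomial τ ℂ, ∀ p, eval p P = F p := by
  simp only [mvPolynomialFunctions, AlgHom.mem_range, funext_iff, AlgHom.pi_apply, aeval_eq_eval]

lemma coord_mem_mvPolynomialFunctions {τ : Type*} (i : τ) :
    (fun p : τ → ℂ => p i) ∈ mvPolynomialFunctions τ :=
  mem_mvPolynomialFunctions.2 ⟨X i, fun p => by simp⟩

lemma const_mem_mvPolynomialFunctions (τ : Type*) (z : ℂ) :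
    (fun _ : τ → ℂ => z) ∈ mvPolynomialFunctions τ :=
  mem_mvPolynomialFunctions.2 ⟨C z, fun p => by simp⟩

lemma linearMap_comp_mem_mvPolynomialFunctions {τ : Type*} {F : (τ → ℂ) → Fin n → ℂ}
    (hF : ∀ j, (fun p => F p j) ∈ mvPolynomialFunctions τ) (α : (Fin n → ℂ) →ₗ[ℂ] ℂ) :
    (fun p => α (F p)) ∈ mvPolynomialFunctions τ := by
  have : (fun p => α (F p)) =
      ∑ j, (fun p => F p j) * fun _ => α (fun i => if j = i then 1 else 0) := by
    funext p
    rw [α.pi_apply_eq_sum_univ (F p)]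
    simp
  rw [this]
  exact sum_mem fun j _ => mul_mem (hF j) (const_mem_mvPolynomialFunctions τ _)

lemma bilinear_comp_mem_mvPolynomialFunctions {τ : Type*} {F : (τ → ℂ) → Fin n → ℂ}
    (hF : ∀ j, (fun p => F p j) ∈ mvPolynomialFunctions τ)
    (B : (Fin n → ℂ) →ₗ[ℂ] (Fin n → ℂ) →ₗ[ℂ] ℂ) :
    (fun p => B (F p) (F p)) ∈ mvPolynomialFunctions τ := by
  have : (fun p => B (F p) (F p)) =
      ∑ j, (fun p => F p j) * fun p => B.flip (F p) (fun i => if j = i then 1 else 0) := by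
    funext p
    rw [← LinearMap.flip_apply, (B.flip (F p)).pi_apply_eq_sum_univ (F p)]
    simp
  rw [this]
  exact sum_mem fun j _ => mul_mem (hF j) (linearMap_comp_mem_mvPolynomialFunctions hF _)

/-- Parametrization of the cone `φ₀ φ₁ = φ₂ φ₃` by `(s, t, u, v, r)`, where `f` is dual to `φ`. -/
noncomputable def coneMap (φ : Fin 4 → (Fin n → ℂ) →ₗ[ℂ] ℂ) (f : Fin 4 → Fin n → ℂ)
    (p : Fin 4 ⊕ Fin n → ℂ) : Fin n → ℂ :=
  (p (.inl 0) * p (.inl 2)) • f 0 + (p (.inl 1) * p (.inl 3)) • f 1 +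
    (p (.inl 0) * p (.inl 3)) • f 2 + (p (.inl 1) * p (.inl 2)) • f 3 +
    ((fun j => p (.inr j)) - ∑ i, φ i (fun j => p (.inr j)) • f i)

lemma coneMap_mem_mvPolynomialFunctions (φ : Fin 4 → (Fin n → ℂ) →ₗ[ℂ] ℂ) (f : Fin 4 → Fin n → ℂ)
    (j : Fin n) : (fun p => coneMap φ f p j) ∈ mvPolynomialFunctions (Fin 4 ⊕ Fin n) := by
  have hterm : ∀ i k l, (fun p : Fin 4 ⊕ Fin n → ℂ => p (.inl k) * p (.inl l) * f i j) ∈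
      mvPolynomialFunctions (Fin 4 ⊕ Fin n) := fun i k l =>
    mul_mem (mul_mem (coord_mem_mvPolynomialFunctions _) (coord_mem_mvPolynomialFunctions _))
      (const_mem_mvPolynomialFunctions _ _)
  have hlin : ∀ i, (fun p : Fin 4 ⊕ Fin n → ℂ => φ i (fun j => p (.inr j)) * f i j) ∈
      mvPolynomialFunctions (Fin 4 ⊕ Fin n) := fun i =>
    mul_mem (linearMap_comp_mem_mvPolynomialFunctions
      (fun _ => coord_mem_mvPolynomialFunctions _) _) (const_mem_mvPolynomialFunctions _ _)
  have := add_mem (add_mem (add_mem (add_mem (hterm 0 0 2) (hterm 1 1 3)) (hterm 2 0 3))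
    (hterm 3 1 2)) (sub_mem (coord_mem_mvPolynomialFunctions (Sum.inr j))
      (sum_mem fun i (_ : i ∈ Finset.univ) => hlin i))
  convert! this using 1

lemma apply_coneMap {φ : Fin 4 → (Fin n → ℂ) →ₗ[ℂ] ℂ} {f : Fin 4 → Fin n → ℂ}
    (hf : ∀ i j, φ i (f j) = if i = j then 1 else 0) (p : Fin 4 ⊕ Fin n → ℂ) :
    φ 0 (coneMap φ f p) = p (.inl 0) * p (.inl 2) ∧
    φ 1 (coneMap φ f p) = p (.inl 1) * p (.inl 3) ∧
    φ 2 (coneMap φ f p) = p (.inl 0) * p (.inl 3) ∧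
    φ 3 (coneMap φ f p) = p (.inl 1) * p (.inl 2) := by
  simp [coneMap, hf]

lemma coneMap_eq {φ : Fin 4 → (Fin n → ℂ) →ₗ[ℂ] ℂ} (f : Fin 4 → Fin n → ℂ) {w : Fin n → ℂ}
    {c : Fin 4 → ℂ}
    (hw : φ 0 w = c 0 * c 2 ∧ φ 1 w = c 1 * c 3 ∧ φ 2 w = c 0 * c 3 ∧ φ 3 w = c 1 * c 2) :
    coneMap φ f (Sum.elim c w) = w := by
  obtain ⟨h0, h1, h2, h3⟩ := hw
  simp [coneMap, Fin.sum_univ_four, h0, h1, h2, h3]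

/-- If a product of members of the shape `Q + a b` or `ℓ²` lies in the radical of
`⟨Q + x₀ x₁, Q + x₂ x₃⟩`, where `Q` has large rank and the `xᵢ` are independent linear forms,
then one of the members is a generator or zero. -/
theorem exists_factor_eq_of_prod_mem_radical {ι : Type*} {Q : MvPolynomial (Fin n) ℂ}
    (hQ : Q.IsHomogeneous 2) (hrk : 8 < rankS Q) (x : Fin 4 → MvPolynomial (Fin n) ℂ)
    (hx : ∀ i, (x i).IsHomogeneous 1) (hli : LinearIndependent ℂ x) (s : Finset ι)
    (P : ι → MvPolynomial (Fin n) ℂ)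
    (hP : ∀ k ∈ s, (∃ a b : MvPolynomial (Fin n) ℂ, a.IsHomogeneous 1 ∧ b.IsHomogeneous 1 ∧
      P k = Q + a * b) ∨ ∃ l : MvPolynomial (Fin n) ℂ, l.IsHomogeneous 1 ∧ P k = l ^ 2)
    (hrad : ∏ k ∈ s, P k ∈ (Ideal.span {Q + x 0 * x 1, Q + x 2 * x 3}).radical) :
    ∃ k ∈ s, P k = Q + x 0 * x 1 ∨ P k = Q + x 2 * x 3 ∨ P k = 0 := by
  obtain ⟨B, hsymm, hB⟩ := hQ.exists_symm_bilinear
  choose φ hφ using fun i => (hx i).exists_linearMap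
  obtain ⟨f, hf⟩ := exists_dual_vectors x φ (fun i w => hφ i w) hli
  have hnd := exists_ne_zero_of_lt_rankS hrk hsymm hB
  obtain ⟨e, p₀, he, hp₀, hee, hpe⟩ := exists_isotropic_of_nondegenerate B hsymm hnd φ
  have hg : ∀ j, ∃ G : MvPolynomial (Fin 4 ⊕ Fin n) ℂ, ∀ p, eval p G =
      2 * B (coneMap φ f p) e * coneMap φ f p j -
        (B (coneMap φ f p) (coneMap φ f p) + φ 0 (coneMap φ f p) * φ 1 (coneMap φ f p)) * e j := by
    intro j
    have hcone := coneMap_mem_mvPolynomialFunctions φ f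
    have hconst := const_mem_mvPolynomialFunctions (Fin 4 ⊕ Fin n)
    exact mem_mvPolynomialFunctions.1 <| sub_mem
      (mul_mem (mul_mem (hconst 2) (linearMap_comp_mem_mvPolynomialFunctions hcone (B.flip e)))
        (hcone j))
      (mul_mem (add_mem (bilinear_comp_mem_mvPolynomialFunctions hcone B)
        (mul_mem (linearMap_comp_mem_mvPolynomialFunctions hcone (φ 0))
          (linearMap_comp_mem_mvPolynomialFunctions hcone (φ 1)))) (hconst (e j)))
  choose g hg using hg
  have hgv : ∀ p, (fun j => eval p (g j)) = (2 * B (coneMap φ f p) e) • coneMap φ f p -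
      (B (coneMap φ f p) (coneMap φ f p) + φ 0 (coneMap φ f p) * φ 1 (coneMap φ f p)) • e := by
    intro p
    funext j
    simp [hg]
  obtain ⟨k, hk, hvan⟩ := exists_factor_vanishing g (F := Q + x 0 * x 1) (G := Q + x 2 * x 3)
    (by
      intro p
      rw [hgv]
      simp only [map_add, map_mul, hB, hφ, map_sub, map_smul, LinearMap.sub_apply,
        LinearMap.smul_apply, smul_eq_mul, he, hee, hsymm e (coneMap φ f p)]
      ring)
    (by
      intro p
      obtain ⟨h0, h1, h2, h3⟩ := apply_coneMap hf p
      rw [hgv]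
      simp only [map_add, map_mul, hB, hφ, map_sub, map_smul, LinearMap.sub_apply,
        LinearMap.smul_apply, smul_eq_mul, he, hee, hsymm e (coneMap φ f p), h0, h1, h2, h3]
      ring) s P hrad
  have hvan' : ∀ (w : Fin n → ℂ) (c : Fin 4 → ℂ),
      (φ 0 w = c 0 * c 2 ∧ φ 1 w = c 1 * c 3 ∧ φ 2 w = c 0 * c 3 ∧ φ 3 w = c 1 * c 2) →
      B w w + φ 0 w * φ 1 w = 0 → eval ((2 * B w e) • w) (P k) = 0 := by
    intro w c hw hzero
    have := hvan (Sum.elim c w)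
    rwa [hgv, coneMap_eq f hw, hzero, zero_smul, sub_zero] at this
  refine ⟨k, hk, ?_⟩
  rcases hP k hk with ⟨a, b, ha, hb, hab⟩ | ⟨l, hl, hPl⟩
  · obtain ⟨α, hα⟩ := ha.exists_linearMap
    obtain ⟨β, hβ⟩ := hb.exists_linearMap
    have hcone := mul_eq_on_cone_of_mul_eq_on_quadric B hsymm hnd φ hp₀ hpe α β 1 (by
      intro w c hw hzero hwe
      have h := hvan' w c hw hzero
      rw [hab] at h
      simp only [map_add, map_mul, hB, hα, hβ, map_smul, LinearMap.smul_apply, smul_eq_mul] at h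
      have h' : (2 * B w e) ^ 2 * (B w w + α w * β w) = 0 := by linear_combination h
      have := (mul_eq_zero.1 h').resolve_left (by simpa using hwe)
      linear_combination this - hzero)
    simp only [one_mul] at hcone
    rcases mul_eq_or_mul_eq_of_mul_eq_on_cone φ f hf α β hcone with h | h
    · exact Or.inl <| MvPolynomial.funext fun w => by simp [hab, hα, hβ, hφ, h]
    · exact Or.inr <| Or.inl <| MvPolynomial.funext fun w => by simp [hab, hα, hβ, hφ, h]
  · obtain ⟨α, hα⟩ := hl.exists_linearMap
    have hcone := mul_eq_on_cone_of_mul_eq_on_quadric B hsymm hnd φ hp₀ hpe α α 0 (by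
      intro w c hw hzero hwe
      have h := hvan' w c hw hzero
      rw [hPl] at h
      simpa [hα, hwe] using h)
    have h := eq_zero_of_eq_zero_on_cone φ f hf α fun w c hw => by simpa using hcone w c hw
    exact Or.inr <| Or.inr <| MvPolynomial.funext fun w => by simp [hPl, hα, h]

end Parametrization

/-- Claim 5.6 of the paper. Let `𝒬̃` be a `(Q_o,m₁,0)`-set with
`rank_s(Q_o) ≥ 100`, `Q_j = Q_o + a_j·b_j`, with the convention
`a_{m₁+t} = b_{m₁+t} = ℓ_t` (encoded by `Sum.elim a ls`, `Sum.elim b ls`). If the span of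
all the `a_i, b_i` (`i ∈ {1,…,m₁+r}`) has dimension `> 3`, then there is a space `V` of
linear forms of dimension at most `4` such that for every index `k`, either
`b_k ∈ span({a_k} ∪ V)` or `a_k ∈ span({b_k} ∪ V)`. -/
theorem statement17 {n m₁ r : ℕ} (Qo : MvPolynomial (Fin n) ℂ)
    (Qs : Fin m₁ → MvPolynomial (Fin n) ℂ) (ls : Fin r → MvPolynomial (Fin n) ℂ)
    (a b : Fin m₁ → MvPolynomial (Fin n) ℂ)
    (hset : IsQoSet m₁ 0 r Qo Qs (Fin.elim0 : Fin 0 → MvPolynomial (Fin n) ℂ) ls)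
    (hrk : 100 ≤ rankS Qo)
    (ha : ∀ j, (a j).IsHomogeneous 1) (hb : ∀ j, (b j).IsHomogeneous 1)
    (hQ : ∀ j, Qs j = Qo + a j * b j)
    (hdim : 3 < Module.finrank ℂ
      (Submodule.span ℂ (Set.range a ∪ Set.range b ∪ Set.range ls))) :
    ∃ V : Submodule ℂ (MvPolynomial (Fin n) ℂ),
      (∀ x ∈ V, MvPolynomial.IsHomogeneous x 1) ∧ Module.finrank ℂ V ≤ 4 ∧
      ∀ k : Fin m₁ ⊕ Fin r,
        Sum.elim b ls k ∈ Submodule.span ℂ {Sum.elim a ls k} ⊔ V ∨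
        Sum.elim a ls k ∈ Submodule.span ℂ {Sum.elim b ls k} ⊔ V := by
  obtain ⟨⟨hQo, -⟩, -, -, hls, hpair, hrad, -⟩ := hset
  have hdep : ∀ i j, i ≠ j → ¬ LinearIndependent ℂ ![b j, a j, a i, b i] := by
    intro i j hij hli
    have hli' : LinearIndependent ℂ ![a i, b i, a j, b j] := by
      have := hli.comp ![2, 3, 1, 0] (by decide)
      convert this using 1
      funext k
      fin_cases k <;> rfl
    set F := QoFam Qo Qs (Fin.elim0 : Fin 0 → MvPolynomial (Fin n) ℂ) ls with hF
    have hFi : F (.inr (.inl i)) = Qo + a i * b i := hQ i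
    have hFj : F (.inr (.inl j)) = Qo + a j * b j := hQ j
    have hne : (.inr (.inl i) : Unit ⊕ Fin m₁ ⊕ Fin 0 ⊕ Fin r) ≠ .inr (.inl j) := by simpa using hij
    have hprod := hrad _ _ hne
    rw [hFi, hFj] at hprod
    obtain ⟨k, hk, hPk⟩ := exists_factor_eq_of_prod_mem_radical hQo (by omega)
      ![a i, b i, a j, b j]
      (by
        intro k
        fin_cases k
        exacts [ha i, hb i, ha j, hb j]) hli' _ F
      (by
        rintro (k | k | k | k) -
        · exact Or.inl ⟨0, 0, isHomogeneous_zero _ _ _, isHomogeneous_zero _ _ _, by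
            simp [hF, QoFam]⟩
        · exact Or.inl ⟨a k, b k, ha k, hb k, hQ k⟩
        · exact k.elim0
        · exact Or.inr ⟨ls k, hls k, rfl⟩) hprod
    have hinj : ∀ k l, k ≠ l → F k ≠ F l := by
      intro k l hkl heq
      have := (hpair k l hkl).injective.ne (show (0 : Fin 2) ≠ 1 by decide)
      exact this heq
    simp only [Finset.mem_erase, Finset.mem_univ, and_true] at hk
    rcases hPk with h | h | h
    · exact hinj _ _ hk.2 (h.trans hFi.symm)
    · exact hinj _ _ hk.1 (h.trans hFj.symm)
    · exact (hpair k _ hk.1).ne_zero 0 h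
  by_cases hex : ∃ i, LinearIndependent ℂ ![a i, b i]
  · obtain ⟨i, hi⟩ := hex
    refine ⟨Submodule.span ℂ (Set.range ![a i, b i]), ?_, ?_, ?_⟩
    · suffices h : Submodule.span ℂ (Set.range ![a i, b i]) ≤ homogeneousSubmodule (Fin n) ℂ 1 from
        fun x hx => h hx
      rw [Submodule.span_le]
      rintro _ ⟨k, rfl⟩
      fin_cases k
      exacts [ha i, hb i]
    · exact (finrank_range_le_card ![a i, b i]).trans (by simp)
    · rintro (j | t)
      · simp only [Sum.elim_inl]
        by_contra! hnot
        obtain ⟨hbj, haj⟩ := hnot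
        have haj' : a j ∉ Submodule.span ℂ (Set.range ![a i, b i]) := fun h =>
          haj (Submodule.mem_sup_right h)
        refine hdep i j ?_ ?_
        · rintro rfl
          exact haj' (Submodule.subset_span ⟨0, rfl⟩)
        · have h3 : LinearIndependent ℂ ![a j, a i, b i] := linearIndependent_finCons.2 ⟨hi, haj'⟩
          refine linearIndependent_finCons.2 ⟨h3, ?_⟩
          rwa [Matrix.range_cons, Submodule.span_union]
      · exact Or.inl (Submodule.mem_sup_left (Submodule.mem_span_singleton_self _))
  · refine ⟨⊥, fun x hx => ?_, by simp, ?_⟩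
    · rw [(Submodule.mem_bot ℂ).1 hx]
      exact isHomogeneous_zero _ _ _
    · rintro (j | t)
      · by_contra! hnot
        simp only [Sum.elim_inl, sup_bot_eq, Submodule.mem_span_singleton, not_exists] at hnot
        refine hex ⟨j, linearIndependent_fin2.2 ⟨?_, hnot.2⟩⟩
        intro h
        exact hnot.1 0 (by simpa using h.symm)
      · exact Or.inl (Submodule.mem_sup_left (Submodule.mem_span_singleton_self _))
end
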